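/- arXiv:1901.07386 — 2 statements merged into one kernel-verified Lean document; each statement's English description precedes it below -/
import Mathlib

section
/- There exists a constant c > 0 such that, as X → ∞, Σ_{𝔞 ⊂ ℤ[i], θ_𝔞 = 0} Λ(𝔞) Φ(N(𝔞)/X) = (1/2)·X^{1/2}·Φ̃(1/2) + O_Φ(√X · e^{−c·√(log X)}), where the sum runs over all nonzero ideals 𝔞 of ℤ[i] with θ_𝔞 = 0. -/
noncomputable section

open scoped Classical

open Complex Real Filter Asymptotics MeasureTheory

/-- The norm of an ideal of `ℤ[i]`: the cardinality of the quotient ring. -/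
def idealNorm (I : Ideal GaussianInt) : ℕ := Nat.card (GaussianInt ⧸ I)

/-- The angle `θ_𝔞 ∈ [0, π/2)` attached to a nonzero ideal of `ℤ[i]`: the argument of
the generator lying in the first quadrant. -/
def idealTheta (I : Ideal GaussianInt) : ℝ :=
  if h : ∃ α : GaussianInt, Ideal.span {α} = I ∧
      (GaussianInt.toComplex α).arg ∈ Set.Ico 0 (π / 2)
  then (GaussianInt.toComplex h.choose).arg else 0

/-- The von Mangoldt function on ideals of `ℤ[i]`: `Λ(𝔞) = log N(𝔭)` if `𝔞 = 𝔭^r` is a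
power of a nonzero prime ideal `𝔭`, and `Λ(𝔞) = 0` otherwise. -/
def idealLambda (I : Ideal GaussianInt) : ℝ :=
  if h : ∃ P : Ideal GaussianInt, ∃ r : ℕ, P.IsPrime ∧ P ≠ ⊥ ∧ 0 < r ∧ I = P ^ r
  then Real.log (idealNorm h.choose) else 0

/-- The Mellin transform `Φ̃(c) = ∫₀^∞ Φ(x) x^{c-1} dx` at a real point `c`. -/
def mellinR (Φ : ℝ → ℝ) (c : ℝ) : ℝ := ∫ x in Set.Ioi (0:ℝ), Φ x * x ^ (c - 1)

/-- The sum `∑_{𝔞, θ_𝔞 = 0} Λ(𝔞) Φ(N(𝔞)/X)` over nonzero ideals of `ℤ[i]` with `θ_𝔞 = 0`. -/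
def inertSum (Φ : ℝ → ℝ) (X : ℝ) : ℝ :=
  ∑' I : {I : Ideal GaussianInt // I ≠ ⊥ ∧ idealTheta I = 0},
    idealLambda I.1 * Φ ((idealNorm I.1 : ℝ) / X)

/-- A nonvanishing holomorphic function on a disc which is at most `exp M` times its value at the
centre has logarithmic derivative `O(M / r)` on the half disc. -/
lemma norm_logDeriv_le_of_ne_zero {f : ℂ → ℂ} {c : ℂ} {r M : ℝ} (hr : 0 < r) (hM : 0 < M)
    (hf : DifferentiableOn ℂ f (Metric.ball c r)) (h0 : ∀ z ∈ Metric.ball c r, f z ≠ 0)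
    (hb : ∀ z ∈ Metric.ball c r, ‖f z‖ ≤ Real.exp M * ‖f c‖) {z : ℂ}
    (hz : z ∈ Metric.closedBall c (r / 2)) : ‖logDeriv f z‖ ≤ 24 * M / r := by
  have hcr : c ∈ Metric.ball c r := Metric.mem_ball_self hr
  have hfat : ∀ w ∈ Metric.ball c r, DifferentiableAt ℂ f w := fun w hw =>
    hf.differentiableAt (Metric.isOpen_ball.mem_nhds hw)
  have hld : DifferentiableOn ℂ (logDeriv f) (Metric.ball c r) :=
    (hf.deriv Metric.isOpen_ball).div hf h0
  obtain ⟨g, hg0, hg⟩ := hld.isExactOn_ball.with_val_at c 0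
  have hconst : ∀ w ∈ Metric.ball c r, f w * cexp (-g w) = f c := by
    intro w hw
    have key : ∀ x ∈ Metric.ball c r, HasDerivAt (fun y => f y * cexp (-g y)) 0 x := by
      intro x hx
      have h1 := (hfat x hx).hasDerivAt.mul (hg x hx).neg.cexp
      refine HasDerivAt.congr_deriv (f := fun y => f y * cexp (-g y)) h1 ?_
      have := h0 x hx
      rw [logDeriv_apply, Pi.neg_apply]
      field_simp
      ring
    have := (convex_ball c r).is_const_of_fderivWithin_eq_zero (𝕜 := ℂ)
      (f := fun y => f y * cexp (-g y))
      (fun x hx => (key x hx).differentiableAt.differentiableWithinAt) (fun x hx => by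
        rw [fderivWithin_of_isOpen Metric.isOpen_ball hx]
        ext
        simpa using (key x hx).deriv) hw hcr
    simpa [hg0] using this
  have hre : ∀ w ∈ Metric.ball c r, (g w).re ≤ M := by
    intro w hw
    have h1 : ‖f w‖ = ‖f c‖ * Real.exp (g w).re := by
      rw [← hconst w hw, norm_mul, Complex.norm_exp, Complex.neg_re, mul_assoc, ← Real.exp_add]
      simp
    have h2 := hb w hw
    have h3 : 0 < ‖f c‖ := norm_pos_iff.2 (h0 c hcr)
    rw [h1, mul_comm] at h2
    exact Real.exp_le_exp.1 (le_of_mul_le_mul_right h2 h3)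
  have hgb : ∀ w : ℂ, ‖w - c‖ ≤ 3 * r / 4 → ‖g w‖ ≤ 6 * M := by
    intro w hw
    have h1 : DifferentiableOn ℂ (fun u => g (c + u)) (Metric.ball 0 r) := by
      intro u hu
      have hu' : c + u ∈ Metric.ball c r := by simpa using hu
      exact ((hg _ hu').differentiableAt.comp u (by fun_prop)).differentiableWithinAt
    have h2 := Complex.borelCaratheodory_zero (f := fun u => g (c + u)) (z := w - c) hM h1
      (fun u hu => hre _ (by simpa using hu)) hr (by simp; linarith) (by simpa using hg0)
    simp only [add_sub_cancel] at h2
    refine h2.trans ?_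
    rw [div_le_iff₀ (by linarith)]
    nlinarith [norm_nonneg (w - c)]
  have hz' : ‖z - c‖ ≤ r / 2 := by simpa [dist_eq_norm] using hz
  have hsub : ∀ w, dist w z ≤ r / 4 → ‖w - c‖ ≤ 3 * r / 4 := by
    intro w hw
    rw [dist_eq_norm] at hw
    calc ‖w - c‖ = ‖(w - z) + (z - c)‖ := by ring_nf
      _ ≤ ‖w - z‖ + ‖z - c‖ := norm_add_le _ _
      _ ≤ _ := by linarith
  have hmem : ∀ w, dist w z ≤ r / 4 → w ∈ Metric.ball c r := fun w hw => by
    rw [Metric.mem_ball, dist_eq_norm]; linarith [hsub w hw]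
  have hd : DiffContOnCl ℂ g (Metric.ball z (r / 4)) := by
    apply DifferentiableOn.diffContOnCl
    rw [closure_ball _ (by positivity)]
    intro w hw
    exact (hg w (hmem w hw)).differentiableAt.differentiableWithinAt
  have := Complex.norm_deriv_le_of_forall_mem_sphere_norm_le (by positivity) hd
    (fun w hw => hgb w (hsub w (le_of_eq hw)))
  rw [(hg z (hmem z (by simp; positivity))).deriv] at this
  refine this.trans (le_of_eq ?_)
  field_simp
  ring

lemma norm_sq_sub_conj_mul_of_norm_eq {R : ℝ} {ρ z : ℂ} (hR : 0 < R) (hz : ‖z‖ = R) :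
    ‖((R : ℂ) ^ 2 - (starRingEnd ℂ) ρ * z) / R‖ = ‖z - ρ‖ := by
  have h1 : (R : ℂ) ^ 2 - (starRingEnd ℂ) ρ * z = z * (starRingEnd ℂ) (z - ρ) := by
    have : (R : ℂ) ^ 2 = z * (starRingEnd ℂ) z := by
      rw [Complex.mul_conj, Complex.normSq_eq_norm_sq, hz]; push_cast; ring
    rw [this, map_sub]; ring
  rw [h1, norm_div, norm_mul, RCLike.norm_conj, hz, Complex.norm_real, Real.norm_eq_abs,
    abs_of_pos hR]
  field_simp

/-- Replacing the zero factor `(z - ρ) ^ n` of `f` by a Blaschke type factor. -/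
lemma exists_blaschke_replacement {f g : ℂ → ℂ} {R : ℝ} {ρ : ℂ} {n : ℕ} (hR : 0 < R)
    (hρ : ‖ρ‖ < R) (hρ0 : ρ ≠ 0) (hg : Differentiable ℂ g)
    (hfg : ∀ z, f z = (z - ρ) ^ n * g z) (hf0 : f 0 ≠ 0) :
    ∃ F : ℂ → ℂ, Differentiable ℂ F ∧ F 0 ≠ 0 ∧ (∀ z, ‖z‖ = R → ‖F z‖ = ‖f z‖) ∧
      ‖f 0‖ ≤ ‖F 0‖ ∧ (∀ z, ‖z‖ < R → (F z = 0 ↔ g z = 0)) ∧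
      logDeriv f 0 = logDeriv F 0 + n * (-1 / ρ + (starRingEnd ℂ) ρ / R ^ 2) := by
  have hRC : (R : ℂ) ≠ 0 := by exact_mod_cast hR.ne'
  have hg0 : g 0 ≠ 0 := fun h => hf0 (by rw [hfg, h, mul_zero])
  let B : ℂ → ℂ := fun z => ((R : ℂ) ^ 2 - (starRingEnd ℂ) ρ * z) / R
  have hBd : Differentiable ℂ B := by fun_prop
  have hB0 : B 0 = R := by simp [B]; field_simp
  have hBne : ∀ z, ‖z‖ < R → B z ≠ 0 := by
    intro z hz h
    have h1 : (R : ℂ) ^ 2 = (starRingEnd ℂ) ρ * z := by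
      have : (R : ℂ) ^ 2 - (starRingEnd ℂ) ρ * z = 0 := by
        simpa [B, hRC] using h
      linear_combination this
    have h2 := congrArg norm h1
    rw [norm_pow, Complex.norm_real, Real.norm_eq_abs, abs_of_pos hR, norm_mul,
      RCLike.norm_conj] at h2
    nlinarith [norm_nonneg z, norm_nonneg ρ]
  refine ⟨fun z => B z ^ n * g z, (hBd.pow n).mul hg, ?_, ?_, ?_, ?_, ?_⟩
  · simp [hB0, hRC, hg0]
  · intro z hz
    rw [hfg, norm_mul, norm_mul, norm_pow, norm_pow, norm_sq_sub_conj_mul_of_norm_eq hR hz]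
  · simp only [hfg, hB0, norm_mul, norm_pow, zero_sub, norm_neg, Complex.norm_real,
      Real.norm_eq_abs, abs_of_pos hR]
    gcongr
  · intro z hz
    simp [hBne z hz]
  · have e : f = fun z => (z - ρ) ^ n * g z := funext hfg
    have d1 : DifferentiableAt ℂ (fun z : ℂ => z - ρ) 0 := by fun_prop
    have hder : deriv B 0 = -(starRingEnd ℂ) ρ / R := by
      have : HasDerivAt B ((0 - (starRingEnd ℂ) ρ * 1) / R) 0 :=
        (((hasDerivAt_const (0 : ℂ) _).sub ((hasDerivAt_id (0 : ℂ)).const_mul _)).div_const _)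
      rw [this.deriv]; ring
    rw [e, logDeriv_mul _ (by simp [hρ0]) hg0 (by fun_prop) hg.differentiableAt,
      logDeriv_mul _ (by simp [hB0, hRC]) hg0 (by fun_prop) hg.differentiableAt,
      logDeriv_fun_pow d1, logDeriv_fun_pow hBd.differentiableAt, logDeriv_apply (f := B), hder,
          hB0,
      logDeriv_apply]
    simp
    field_simp
    ring

lemma re_blaschke_term_nonneg {R : ℝ} {ρ : ℂ} (hρ : ‖ρ‖ < R) (hρ0 : ρ ≠ 0) (hre : ρ.re ≤ 0) :
    0 ≤ (-1 / ρ + (starRingEnd ℂ) ρ / R ^ 2).re := by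
  have h0 : 0 < ‖ρ‖ := norm_pos_iff.2 hρ0
  have hR : 0 < R := h0.trans hρ
  have h1 : (-1 / ρ + (starRingEnd ℂ) ρ / R ^ 2).re = -ρ.re * (1 / ‖ρ‖ ^ 2 - 1 / R ^ 2) := by
    have e1 : (-1 / ρ).re = -ρ.re / ‖ρ‖ ^ 2 := by
      rw [← Complex.normSq_eq_norm_sq, neg_div, one_div, Complex.neg_re, Complex.inv_re]; ring
    have e2 : ((starRingEnd ℂ) ρ / R ^ 2).re = ρ.re / R ^ 2 := by
      rw [← Complex.ofReal_pow, Complex.div_ofReal_re, Complex.conj_re]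
    rw [Complex.add_re, e1, e2]; ring
  rw [h1]
  refine mul_nonneg (by linarith) (sub_nonneg.2 ?_)
  gcongr

lemma finite_zeros_closedBall {f : ℂ → ℂ} (hf : Differentiable ℂ f) (R : ℝ) (hf0 : f 0 ≠ 0) :
    {z : ℂ | ‖z‖ < R ∧ f z = 0}.Finite := by
  by_contra hinf
  obtain ⟨x, -, hx⟩ := Set.Infinite.exists_accPt_of_subset_isCompact hinf
    (isCompact_closedBall (0 : ℂ) R) (fun z hz => by simpa using hz.1.le)
  have hA : AnalyticOnNhd ℂ f Set.univ := fun z _ => hf.analyticAt z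
  have hfr : ∃ᶠ z in nhdsWithin x {x}ᶜ, f z = 0 := by
    rw [accPt_iff_frequently_nhdsNE] at hx
    exact hx.mono fun z hz => hz.2
  have := hA.eqOn_zero_of_preconnected_of_frequently_eq_zero isPreconnected_univ (Set.mem_univ x)
      hfr
  exact hf0 (this (Set.mem_univ 0))

lemma exists_eq_pow_mul_of_entire {f : ℂ → ℂ} (hf : Differentiable ℂ f) (hf0 : f 0 ≠ 0) (ρ : ℂ) :
    ∃ (n : ℕ) (g : ℂ → ℂ), Differentiable ℂ g ∧ g ρ ≠ 0 ∧ ∀ z, f z = (z - ρ) ^ n * g z := by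
  obtain ⟨p, hp⟩ := hf.analyticAt ρ
  have hp0 : p ≠ 0 := by
    intro h
    have h1 := hp.locally_zero_iff.2 h
    have hA : AnalyticOnNhd ℂ f Set.univ := fun z _ => hf.analyticAt z
    exact hf0 (hA.eqOn_zero_of_preconnected_of_eventuallyEq_zero isPreconnected_univ
      (Set.mem_univ ρ) h1 (Set.mem_univ 0))
  refine ⟨p.order, (Function.swap dslope ρ)^[p.order] f, ?_,
    hp.iterate_dslope_fslope_ne_zero hp0, fun z => by
      simpa using hp.eq_pow_order_mul_iterate_dslope z⟩
  generalize p.order = n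
  induction n with
  | zero => exact hf
  | succ k ih =>
    rw [Function.iterate_succ_apply']
    rw [← differentiableOn_univ] at ih ⊢
    exact (Complex.differentiableOn_dslope Filter.univ_mem).2 ih

lemma neg_le_re_logDeriv_zero {f : ℂ → ℂ} {R M : ℝ} (hR : 0 < R) (hM : 0 < M)
    (hf : Differentiable ℂ f) (hf0 : f 0 ≠ 0)
    (hb : ∀ z, ‖z‖ = R → ‖f z‖ ≤ Real.exp M * ‖f 0‖)
    (hz : ∀ z, ‖z‖ < R → f z = 0 → z.re ≤ 0) : -(24 * M / R) ≤ (logDeriv f 0).re := by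
  obtain ⟨n, hn⟩ : ∃ n, {z : ℂ | ‖z‖ < R ∧ f z = 0}.ncard = n := ⟨_, rfl⟩
  induction n using Nat.strong_induction_on generalizing f with
  | _ n ih =>
    by_cases hne : ∃ ρ : ℂ, ‖ρ‖ < R ∧ f ρ = 0
    · obtain ⟨ρ, hρ, hfρ⟩ := hne
      have hρ0 : ρ ≠ 0 := by rintro rfl; exact hf0 hfρ
      obtain ⟨m, g, hg, hgρ, hfg⟩ := exists_eq_pow_mul_of_entire hf hf0 ρ
      obtain ⟨F, hF, hF0, hFR, hF0', hFz, hFl⟩ := exists_blaschke_replacement hR hρ hρ0 hg hfg hf0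
      have hsub : {z : ℂ | ‖z‖ < R ∧ F z = 0} ⊂ {z : ℂ | ‖z‖ < R ∧ f z = 0} := by
        refine ⟨fun z hz => ⟨hz.1, by rw [hfg, (hFz z hz.1).1 hz.2, mul_zero]⟩, fun h => ?_⟩
        exact hgρ ((hFz ρ hρ).1 (h ⟨hρ, hfρ⟩).2)
      have h1 := ih _ (hn ▸ Set.ncard_lt_ncard hsub (finite_zeros_closedBall hf R hf0)) hF hF0
        (fun z hz => by rw [hFR z hz]; exact (hb z hz).trans (by gcongr))
        (fun z hz hz0 => hz0 |> fun h => by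
          exact (‹∀ z, ‖z‖ < R → f z = 0 → z.re ≤ 0›) z hz (hsub.1 ⟨hz, h⟩).2) rfl
      have h2 := re_blaschke_term_nonneg hρ hρ0 (hz ρ hρ hfρ)
      rw [hFl, Complex.add_re, ← Complex.ofReal_natCast, Complex.re_ofReal_mul]
      have : 0 ≤ (m : ℝ) * (-1 / ρ + (starRingEnd ℂ) ρ / R ^ 2).re := by positivity
      linarith
    · push Not at hne
      have hball : ∀ z ∈ Metric.ball (0 : ℂ) R, ‖f z‖ ≤ Real.exp M * ‖f 0‖ := by
        intro z hz
        refine Complex.norm_le_of_forall_mem_frontier_norm_le Metric.isBounded_ball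
          hf.diffContOnCl (fun w hw => hb w ?_) (subset_closure hz)
        rw [frontier_ball _ hR.ne'] at hw
        simpa using hw
      have := norm_logDeriv_le_of_ne_zero hR hM hf.differentiableOn
        (fun z hz => hne z (by simpa using hz)) hball (z := 0) (by simp; positivity)
      have h2 := Complex.abs_re_le_norm (logDeriv f 0)
      have h3 := neg_abs_le (logDeriv f 0).re
      linarith

/-- Landau's lemma without zeros. -/
lemma neg_le_re_logDeriv {f : ℂ → ℂ} {c : ℂ} {R M : ℝ} (hR : 0 < R) (hM : 0 < M)
    (hf : Differentiable ℂ f) (hf0 : f c ≠ 0)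
    (hb : ∀ z, ‖z - c‖ = R → ‖f z‖ ≤ Real.exp M * ‖f c‖)
    (hz : ∀ z, ‖z - c‖ < R → f z = 0 → z.re ≤ c.re) : -(24 * M / R) ≤ (logDeriv f c).re := by
  have h := neg_le_re_logDeriv_zero (f := fun z => f (c + z)) hR hM (by fun_prop) (by simpa)
    (fun z h => by simpa using hb (c + z) (by simpa)) (fun z h h0 => by
      simpa using hz (c + z) (by simpa) h0)
  simpa [logDeriv_apply, deriv_comp_const_add] using h

/-- Landau's lemma with a zero at distance `d` to the left of the centre. -/
lemma le_re_logDeriv_of_zero {f : ℂ → ℂ} {c : ℂ} {R M d : ℝ} (hR : 0 < R) (hM : 0 < M)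
    (hf : Differentiable ℂ f) (hf0 : f c ≠ 0)
    (hb : ∀ z, ‖z - c‖ = R → ‖f z‖ ≤ Real.exp M * ‖f c‖)
    (hz : ∀ z, ‖z - c‖ < R → f z = 0 → z.re ≤ c.re) (hd : 0 < d) (hdR : d < R)
    (hfd : f (c - d) = 0) : 1 / d - d / R ^ 2 - 24 * M / R ≤ (logDeriv f c).re := by
  let f₁ : ℂ → ℂ := fun z => f (c + z)
  have hf₁ : Differentiable ℂ f₁ := by fun_prop
  have hρ0 : (-(d : ℂ)) ≠ 0 := by simpa using hd.ne'
  have hρ : ‖(-(d : ℂ))‖ < R := by simpa [abs_of_pos hd] using hdR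
  have hzero : f₁ (-(d : ℂ)) = 0 := by simpa [f₁, ← sub_eq_add_neg] using hfd
  have hg : Differentiable ℂ (dslope f₁ (-(d : ℂ))) := by
    rw [← differentiableOn_univ] at hf₁ ⊢
    exact (Complex.differentiableOn_dslope Filter.univ_mem).2 hf₁
  have hfg : ∀ z, f₁ z = (z - (-(d : ℂ))) ^ 1 * dslope f₁ (-(d : ℂ)) z := fun z => by
    have := sub_smul_dslope f₁ (-(d : ℂ)) z
    rw [hzero, sub_zero, smul_eq_mul] at this
    rw [pow_one, this]
  obtain ⟨F, hF, hF0, hFR, hF0', hFz, hFl⟩ :=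
    exists_blaschke_replacement hR hρ hρ0 hg hfg (by simpa [f₁])
  have h1 := neg_le_re_logDeriv_zero hR hM hF hF0
    (fun z h => by
      rw [hFR z h]
      refine (hb (c + z) (by simpa)).trans ?_
      gcongr
      simpa [f₁] using hF0')
    (fun z h h0 => by
      have : f₁ z = 0 := by rw [hfg, (hFz z h).1 h0, mul_zero]
      simpa using hz (c + z) (by simpa) this)
  have h2 : logDeriv f c = logDeriv f₁ 0 := by
    simp [logDeriv_apply, f₁, deriv_comp_const_add]
  have h3 : (((1 : ℕ) : ℂ) * (-1 / (-(d : ℂ)) + (starRingEnd ℂ) (-(d : ℂ)) / R ^ 2))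
      = ((1 / d - d / R ^ 2 : ℝ) : ℂ) := by
    push_cast
    rw [map_neg, Complex.conj_ofReal]
    ring
  rw [h2, hFl, h3, Complex.add_re, Complex.ofReal_re]
  linarith

/-- Growth, nonvanishing and lower bounds used to derive a zero-free region for `(s - 1) L(s)`. -/
structure StripBounds (F : ℂ → ℂ) (C : ℝ) : Prop where
  one_le : 1 ≤ C
  diff : Differentiable ℂ F
  upper : ∀ s : ℂ, 1 / 2 ≤ s.re → s.re ≤ 3 → ‖F s‖ ≤ C * (|s.im| + 3) ^ 2
  ne_zero : ∀ s : ℂ, 1 < s.re → F s ≠ 0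
  lower : ∀ s : ℂ, 1 < s.re → s.re ≤ 2 → 1 ≤ |s.im| → s.re - 1 ≤ C * ‖F s‖

lemma StripBounds.mono {F : ℂ → ℂ} {C C' : ℝ} (h : StripBounds F C) (hC : C ≤ C') :
    StripBounds F C' where
  one_le := h.one_le.trans hC
  diff := h.diff
  upper s h1 h2 := (h.upper s h1 h2).trans (by gcongr)
  ne_zero := h.ne_zero
  lower s h1 h2 h3 := (h.lower s h1 h2 h3).trans (by gcongr)

lemma one_le_log_abs_add_three (t : ℝ) : 1 ≤ Real.log (|t| + 3) := by
  rw [Real.le_log_iff_exp_le (by positivity)]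
  have := Real.exp_one_lt_d9
  have := abs_nonneg t
  linarith

lemma StripBounds.norm_le_exp_mul {F : ℂ → ℂ} {C y t : ℝ} {c z : ℂ} (h : StripBounds F C)
    (hy : 0 < y) (hyC : y ≤ 1) (hz1 : 1 / 2 ≤ z.re) (hz2 : z.re ≤ 3)
    (hzt : |z.im| + 3 ≤ (|t| + 3) ^ 2) (hc : y / Real.log (|t| + 3) ≤ C * ‖F c‖) :
    ‖F z‖ ≤ Real.exp ((5 + Real.log (C ^ 2 / y)) * Real.log (|t| + 3)) * ‖F c‖ := by
  have hC := h.one_le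
  set E := |t| + 3 with hE
  set ℓ := Real.log E with hℓ
  have hE3 : 3 ≤ E := by have := abs_nonneg t; linarith
  have hℓ1 : 1 ≤ ℓ := one_le_log_abs_add_three t
  have hℓE : ℓ ≤ E := (Real.log_le_sub_one_of_pos (by linarith)).trans (by linarith)
  have hexp : Real.exp ℓ = E := Real.exp_log (by linarith)
  have hK : 0 ≤ Real.log (C ^ 2 / y) := by
    apply Real.log_nonneg
    rw [le_div_iff₀ hy]
    nlinarith
  have h1 : E ^ 5 * (C ^ 2 / y) ≤ Real.exp ((5 + Real.log (C ^ 2 / y)) * ℓ) := by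
    have : E ^ 5 * (C ^ 2 / y) = Real.exp (5 * ℓ + Real.log (C ^ 2 / y)) := by
      rw [Real.exp_add, Real.exp_log (by positivity), ← hexp, ← Real.exp_nat_mul]
      norm_num
    rw [this]
    gcongr
    nlinarith
  have h2 : y / (C * ℓ) ≤ ‖F c‖ := by
    rw [div_le_iff₀ (by positivity)]
    rw [div_le_iff₀ (by positivity)] at hc
    linarith
  calc ‖F z‖ ≤ C * (|z.im| + 3) ^ 2 := h.upper z hz1 hz2
    _ ≤ C * (E ^ 2) ^ 2 := by gcongr
    _ ≤ E ^ 5 * C / ℓ := by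
        rw [le_div_iff₀ (by positivity)]
        have : 0 ≤ C * E ^ 4 := by positivity
        nlinarith
    _ = E ^ 5 * (C ^ 2 / y) * (y / (C * ℓ)) := by field_simp
    _ ≤ _ := by gcongr

set_option maxHeartbeats 1600000 in
/-- The zero-free region obtained from the `3-4-1` inequality. -/
lemma exists_zeroFree {F Z : ℂ → ℂ} {C : ℝ} (hF : StripBounds F C) (hZ : StripBounds Z C)
    (h341 : ∀ σ t : ℝ, 1 < σ → σ ≤ 2 → 1 ≤ |t| →
      4 * (logDeriv F (σ + t * I)).re + (logDeriv Z (σ + 2 * t * I)).re ≤ 3 / (σ - 1) + C) :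
    ∃ a > 0, a ≤ 1 ∧ ∀ s : ℂ, 1 ≤ |s.im| → 1 - a / Real.log (|s.im| + 3) ≤ s.re → F s ≠ 0 := by
  have hC := hF.one_le
  have hlogC : 0 ≤ Real.log C := Real.log_nonneg hC
  set K0 := C + 8 + 1200 + 480 * Real.log C with hK0
  have hK0pos : 1 ≤ K0 := by linarith
  set b := K0 + 1000 with hb
  set a := 1 / b ^ 2 with ha
  have hb1 : 1000 ≤ b := by linarith
  have ha0 : 0 < a := by positivity
  have ha1 : a ≤ 1 / 1000 := by
    rw [ha]; gcongr; nlinarith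
  have hKa : Real.log (C ^ 2 / a) = 2 * Real.log C + 2 * Real.log b := by
    rw [ha, div_div_eq_mul_div, div_one, Real.log_mul (by positivity) (by positivity),
      Real.log_pow, Real.log_pow]
    push_cast; ring
  have hlogb : Real.log b ≤ b := (Real.log_le_sub_one_of_pos (by linarith)).trans (by linarith)
  refine ⟨a / 7, by positivity, by linarith, fun s hst hre hzero => ?_⟩
  set t := s.im with ht
  set ℓ := Real.log (|t| + 3) with hℓ
  have hℓ1 : 1 ≤ ℓ := one_le_log_abs_add_three t
  set δ := a / ℓ with hδ
  have hδ0 : 0 < δ := by positivity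
  have hδ1 : δ ≤ a := div_le_self ha0.le hℓ1
  have hδ7 : a / 7 / ℓ = δ / 7 := by rw [hδ]; field_simp
  rw [hδ7] at hre
  have hs1 : s.re ≤ 1 := by
    by_contra h
    exact hF.ne_zero s (not_lt.1 (fun h' => h h'.le) |>.lt_of_ne (fun e => h e.symm.le)) hzero
  set K := 5 + Real.log (C ^ 2 / a) with hK
  have hKpos : 0 < K * ℓ := by
    have : 0 ≤ Real.log b := Real.log_nonneg (by linarith)
    have : 0 < K := by rw [hK, hKa]; linarith
    positivity
  have habs := abs_nonneg t
  set d := 1 + δ - s.re with hd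
  have hd0 : 0 < d := by linarith
  have hd8 : d ≤ 8 / 7 * δ := by linarith
  have hlow : -(24 * (K * ℓ) / (1 / 2)) ≤ (logDeriv Z ((1 + δ : ℝ) + 2 * t * I)).re := by
    have hc1 : (((1 + δ : ℝ) : ℂ) + 2 * t * I).re = 1 + δ := by simp
    have hc2 : (((1 + δ : ℝ) : ℂ) + 2 * t * I).im = 2 * t := by simp
    refine neg_le_re_logDeriv (by norm_num) hKpos hZ.diff (hZ.ne_zero _ (by rw [hc1]; linarith)) ?_
        ?_
    · intro z hz
      have e1 := (Complex.abs_re_le_norm (z - ((1 + δ : ℝ) + 2 * t * I))).trans hz.le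
      have e2 := (Complex.abs_im_le_norm (z - ((1 + δ : ℝ) + 2 * t * I))).trans hz.le
      rw [Complex.sub_re, hc1, abs_le] at e1
      rw [Complex.sub_im, hc2] at e2
      have e3 : |z.im| ≤ 2 * |t| + 1 / 2 := by
        have := abs_sub_abs_le_abs_sub z.im (2 * t)
        rw [abs_mul, abs_two] at this
        linarith
      refine hZ.norm_le_exp_mul (t := t) ha0 (by linarith) (by linarith) (by linarith)
          (by nlinarith) ?_
      refine le_trans ?_ (hZ.lower _ (by rw [hc1]; linarith) (by rw [hc1]; linarith)
        (by rw [hc2, abs_mul, abs_two]; linarith))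
      rw [hc1]; simp [hδ, hℓ]
    · intro z _ hz0
      rw [hc1]
      by_contra h
      exact hZ.ne_zero z (by linarith) hz0
  have hup : 1 / d - d / (1 / 2) ^ 2 - 24 * (K * ℓ) / (1 / 2)
      ≤ (logDeriv F ((1 + δ : ℝ) + t * I)).re := by
    have hc1 : (((1 + δ : ℝ) : ℂ) + t * I).re = 1 + δ := by simp
    have hc2 : (((1 + δ : ℝ) : ℂ) + t * I).im = t := by simp
    refine le_re_logDeriv_of_zero (by norm_num) hKpos hF.diff
      (hF.ne_zero _ (by rw [hc1]; linarith)) ?_ ?_ hd0 (by linarith) ?_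
    · intro z hz
      have e1 := (Complex.abs_re_le_norm (z - ((1 + δ : ℝ) + t * I))).trans hz.le
      have e2 := (Complex.abs_im_le_norm (z - ((1 + δ : ℝ) + t * I))).trans hz.le
      rw [Complex.sub_re, hc1, abs_le] at e1
      rw [Complex.sub_im, hc2] at e2
      have e3 : |z.im| ≤ |t| + 1 / 2 := by
        have := abs_sub_abs_le_abs_sub z.im t
        linarith
      refine hF.norm_le_exp_mul (t := t) ha0 (by linarith) (by linarith) (by linarith)
          (by nlinarith) ?_
      refine le_trans ?_ (hF.lower _ (by rw [hc1]; linarith) (by rw [hc1]; linarith)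
        (by rw [hc2]; linarith))
      rw [hc1]; simp [hδ, hℓ]
    · intro z _ hz0
      rw [hc1]
      by_contra h
      exact hF.ne_zero z (by linarith) hz0
    · rw [← hzero]
      congr 1
      apply Complex.ext <;> simp [hd, ht]
  have hmain := h341 (1 + δ) t (by linarith) (by linarith) hst
  have h1 : 7 / (2 * δ) ≤ 4 / d := by
    rw [div_le_div_iff₀ (by positivity) hd0]; linarith
  have h2 : (1 + δ - 1) = δ := by ring
  rw [h2] at hmain
  have h3 : 1 / (2 * δ) ≤ C + 8 + 240 * (K * ℓ) := by
    have e1 : 7 / (2 * δ) = 3 / δ + 1 / (2 * δ) := by field_simp; norm_num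
    have e2 : 4 / d = 4 * (1 / d) := by ring
    have e3 : d / (1 / 2) ^ 2 = 4 * d := by ring
    rw [e3] at hup
    linarith
  have h4 : 1 / (2 * δ) = b ^ 2 / 2 * ℓ := by rw [hδ, ha]; field_simp
  rw [h4] at h3
  have h5 : b ^ 2 / 2 ≤ C + 8 + 240 * K := by
    by_contra h
    push Not at h
    have : (C + 8) * 1 ≤ (C + 8) * ℓ := by gcongr
    nlinarith
  rw [hK, hKa] at h5
  nlinarith

lemma exists_logDeriv_bound {F Z : ℂ → ℂ} {C : ℝ} (hF : StripBounds F C) (hZ : StripBounds Z C)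
    (h341 : ∀ σ t : ℝ, 1 < σ → σ ≤ 2 → 1 ≤ |t| →
      4 * (logDeriv F (σ + t * I)).re + (logDeriv Z (σ + 2 * t * I)).re ≤ 3 / (σ - 1) + C) :
    ∃ a > 0, ∃ B, ∀ s : ℂ, 2 ≤ |s.im| → 1 - a / Real.log (|s.im| + 3) ≤ s.re → s.re ≤ 2 →
      F s ≠ 0 ∧ ‖logDeriv F s‖ ≤ B * Real.log (|s.im| + 3) ^ 2 := by
  obtain ⟨a, ha0, ha1, hzf⟩ := exists_zeroFree hF hZ h341
  have hC := hF.one_le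
  refine ⟨a / 8, by positivity, 32 * (5 + Real.log (C ^ 2 / (a / 4))) / a, fun s hst hre hre2 => ?_⟩
  set t := s.im with ht
  set ℓ := Real.log (|t| + 3) with hℓ
  have hℓ1 : 1 ≤ ℓ := one_le_log_abs_add_three t
  set κ := a / (2 * ℓ) with hκ
  have hκ0 : 0 < κ := by positivity
  have hκ1 : κ ≤ 1 / 2 := by rw [hκ, div_le_iff₀ (by positivity)]; nlinarith
  have h8 : a / 8 / ℓ = κ / 4 := by rw [hκ]; field_simp; norm_num
  rw [h8] at hre
  refine ⟨hzf s (by linarith) (by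
    have : a / ℓ = 2 * κ := by rw [hκ]; field_simp
    rw [← ht, ← hℓ, this]; linarith), ?_⟩
  set c : ℂ := (max s.re (1 + κ / 2) : ℝ) + t * I with hc
  have hc1 : c.re = max s.re (1 + κ / 2) := by simp [hc]
  have hc2 : c.im = t := by simp [hc]
  have hcl : 1 + κ / 2 ≤ c.re := hc1 ▸ le_max_right _ _
  have hcu : c.re ≤ 2 := hc1 ▸ max_le hre2 (by linarith)
  have habs := abs_nonneg t
  have hball : ∀ z ∈ Metric.ball c (3 * κ / 2), 1 - κ ≤ z.re ∧ z.re ≤ 3 ∧ |z.im| ≤ |t| + 1 ∧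
      |t| - 1 ≤ |z.im| := by
    intro z hz
    rw [Metric.mem_ball, dist_eq_norm] at hz
    have e1 := (Complex.abs_re_le_norm (z - c)).trans hz.le
    have e2 := (Complex.abs_im_le_norm (z - c)).trans hz.le
    rw [Complex.sub_re, abs_le] at e1
    rw [Complex.sub_im, hc2] at e2
    have e3 := abs_sub_abs_le_abs_sub z.im t
    have e4 := abs_sub_abs_le_abs_sub t z.im
    rw [abs_sub_comm] at e4
    refine ⟨by linarith, by linarith, by linarith, by linarith⟩
  have hK : 0 ≤ Real.log (C ^ 2 / (a / 4)) := by
    apply Real.log_nonneg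
    rw [le_div_iff₀ (by positivity)]
    nlinarith
  have hlow : a / 4 / ℓ ≤ C * ‖F c‖ := by
    refine le_trans ?_ (hF.lower c (by linarith) hcu (by rw [hc2]; linarith))
    have : a / 4 / ℓ = κ / 2 := by rw [hκ]; field_simp; norm_num
    rw [this]; linarith
  have := norm_logDeriv_le_of_ne_zero (f := F) (c := c) (r := 3 * κ / 2)
    (M := (5 + Real.log (C ^ 2 / (a / 4))) * ℓ) (by positivity) (by positivity)
    hF.diff.differentiableOn (fun z hz => by
      obtain ⟨h1, h2, h3, h4⟩ := hball z hz
      refine hzf z (by linarith) ?_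
      have hz1 := one_le_log_abs_add_three z.im
      have : Real.log (|z.im| + 3) ≤ 2 * ℓ := by
        have e : 2 * ℓ = Real.log ((|t| + 3) ^ 2) := by rw [Real.log_pow]; push_cast; ring
        rw [e]
        apply Real.log_le_log (by positivity)
        nlinarith
      have h5 : κ ≤ a / Real.log (|z.im| + 3) := by rw [hκ]; gcongr
      linarith) (fun z hz => by
      obtain ⟨h1, h2, h3, h4⟩ := hball z hz
      exact hF.norm_le_exp_mul (by positivity) (by linarith) (by linarith) h2 (by nlinarith) hlow)
    (z := s) (by
      rw [Metric.mem_closedBall, dist_eq_norm]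
      have : s - c = ((s.re - c.re : ℝ) : ℂ) := by
        apply Complex.ext <;> simp [hc2, ht]
      rw [this, Complex.norm_real, Real.norm_eq_abs, abs_le]
      rcases max_cases s.re (1 + κ / 2) with ⟨h, h'⟩ | ⟨h, h'⟩ <;> rw [hc1, h] <;>
        constructor <;> linarith)
  refine this.trans (le_of_eq ?_)
  rw [hκ]
  field_simp
  ring

/-- Polynomial growth of `(s - 1) ∑ f(n) n⁻ˢ` left of the line of absolute convergence, for a
coefficient sequence with bounded deviation of its summatory function from a linear one. -/
lemma norm_le_of_summatory {f : ℕ → ℂ} {κ : ℂ} {K : ℝ} {F : ℂ → ℂ} (hf : ∀ n, ‖f n‖ ≤ 1)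
    (hK : ∀ t : ℝ, 1 ≤ t → ‖∑ k ∈ Finset.Icc 1 ⌊t⌋₊, f k - κ * t‖ ≤ K)
    (hF : Differentiable ℂ F) (hFs : ∀ s : ℂ, 1 < s.re → F s = (s - 1) * LSeries f s)
    (s : ℂ) (hs1 : 1 / 2 ≤ s.re) (hs2 : s.re ≤ 3) :
    ‖F s‖ ≤ (‖κ‖ + 2 * K) * (|s.im| + 3) ^ 2 := by
  set E : ℝ → ℂ := Set.indicator (Set.Ioi 1) fun t => ∑ k ∈ Finset.Icc 1 ⌊t⌋₊, f k - κ * t with hE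
  have hK0 : 0 ≤ K := (norm_nonneg _).trans (hK 1 le_rfl)
  have hEb : ∀ t, ‖E t‖ ≤ K := by
    intro t
    rw [hE]
    by_cases ht : t ∈ Set.Ioi (1 : ℝ)
    · rw [Set.indicator_of_mem ht]; exact hK t (le_of_lt ht)
    · rw [Set.indicator_of_notMem ht]; simpa using hK0
  have hEm : Measurable E := by
    refine Measurable.indicator ?_ measurableSet_Ioi
    refine Measurable.sub ?_ (by fun_prop)
    exact (measurable_from_nat (f := fun n => ∑ k ∈ Finset.Icc 1 n, f k)).comp Nat.measurable_floor
  have hloc : LocallyIntegrableOn E (Set.Ioi 0) volume := by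
    refine LocallyIntegrable.locallyIntegrableOn ?_ _
    refine (locallyIntegrable_const K).mono hEm.aestronglyMeasurable ?_
    exact Eventually.of_forall fun t => (hEb t).trans (le_abs_self K)
  have hdiff : ∀ w : ℂ, w.re < 0 → DifferentiableAt ℂ (mellin E) w := by
    intro w hw
    refine mellin_differentiableAt_of_isBigO_rpow (a := 0) (b := w.re - 1) hloc ?_ hw ?_
        (by linarith)
    · simp only [neg_zero, Real.rpow_zero]
      exact IsBigO.of_bound K (Eventually.of_forall fun t => by simpa using hEb t)
    · refine IsBigO.of_bound 1 ?_
      filter_upwards [Ioo_mem_nhdsGT (show (0 : ℝ) < 1 by norm_num)] with t ht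
      rw [hE, Set.indicator_of_notMem (by simpa using ht.2.le)]
      simp
  have hmel : ∀ w : ℂ, mellin E (-w) = ∫ t in Set.Ioi (1 : ℝ), (t : ℂ) ^ (-w - 1) • E t := by
    intro w
    rw [mellin, ← integral_indicator measurableSet_Ioi, ← integral_indicator measurableSet_Ioi]
    congr 1
    ext t
    by_cases ht : 1 < t
    · rw [Set.indicator_of_mem (by simp; linarith), Set.indicator_of_mem (by simpa using ht)]
    · rw [Set.indicator_of_notMem (a := t) (s := Set.Ioi 1) (by simpa using ht), Set.indicator]
      split_ifs
      · simp [hE, ht]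
      · rfl
  have hbd : ∀ w : ℂ, 0 < w.re → ‖mellin E (-w)‖ ≤ K / w.re := by
    intro w hw
    rw [hmel]
    have h2 : ∫ t in Set.Ioi (1 : ℝ), K * t ^ (-w.re - 1) = K / w.re := by
      rw [integral_const_mul, integral_Ioi_rpow_of_lt (by linarith) one_pos]
      simp
      field_simp
    rw [← h2]
    refine norm_integral_le_of_norm_le ?_ ?_
    · exact (integrableOn_Ioi_rpow_of_lt (by linarith) one_pos).const_mul K
    · filter_upwards [ae_restrict_mem measurableSet_Ioi] with t ht
      have ht0 : 0 < t := lt_trans one_pos ht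
      rw [norm_smul, Complex.norm_cpow_eq_rpow_re_of_pos ht0, mul_comm]
      simp only [sub_re, neg_re, one_re]
      gcongr
      exact hEb t
  set G : ℂ → ℂ := fun w => κ * w + (w - 1) * w * mellin E (-w) with hG
  have hGd : DifferentiableOn ℂ G {w | 0 < w.re} := by
    intro w hw
    refine DifferentiableAt.differentiableWithinAt ?_
    have : DifferentiableAt ℂ (fun w => mellin E (-w)) w :=
      DifferentiableAt.comp (g := mellin E) w (hdiff (-w) (by simpa using hw))
          differentiableAt_id.neg
    rw [hG]
    fun_prop
  have hopen : IsOpen {w : ℂ | 0 < w.re} := isOpen_lt continuous_const Complex.continuous_re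
  have hGF : ∀ w : ℂ, 1 < w.re → F w = G w := by
    intro w hw
    have hsum : LSeriesSummable f w := by
      refine LSeriesSummable_of_bounded_of_one_lt_re (m := 1) (fun n _ => hf n) hw
    have hO : (fun n => ∑ k ∈ Finset.Icc 1 n, f k) =O[atTop] fun n => (n : ℝ) ^ (1 : ℝ) := by
      refine IsBigO.of_bound 1 (Eventually.of_forall fun n => ?_)
      refine (norm_sum_le _ _).trans ((Finset.sum_le_card_nsmul _ _ 1 fun k _ => hf k).trans ?_)
      simp
    rw [hFs w hw, LSeries_eq_mul_integral f zero_le_one hw hsum hO]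
    have hw0 : w - 1 ≠ 0 := by
      intro h; have := congrArg Complex.re h; simp at this; linarith
    have hint1 : IntegrableOn (fun t : ℝ => κ * (t : ℂ) ^ (-w)) (Set.Ioi 1) :=
      (integrableOn_Ioi_cpow_of_lt (by simpa using hw) one_pos).const_mul κ
    have hint2 : IntegrableOn (fun t : ℝ => (t : ℂ) ^ (-w - 1) • E t) (Set.Ioi 1) := by
      refine Integrable.mono' (g := fun t : ℝ => K * t ^ (-w.re - 1))
        ((integrableOn_Ioi_rpow_of_lt (by linarith) one_pos).const_mul K) ?_ ?_
      · refine AEStronglyMeasurable.fun_smul ?_ hEm.aestronglyMeasurable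
        exact (Measurable.pow_const (by fun_prop) _).aestronglyMeasurable
      · filter_upwards [ae_restrict_mem measurableSet_Ioi] with t ht
        have ht0 : 0 < t := lt_trans one_pos ht
        rw [norm_smul, Complex.norm_cpow_eq_rpow_re_of_pos ht0, mul_comm]
        simp only [sub_re, neg_re, one_re]
        gcongr
        exact hEb t
    have h1 : ∫ t in Set.Ioi (1 : ℝ), (∑ k ∈ Finset.Icc 1 ⌊t⌋₊, f k) * (t : ℂ) ^ (-(w + 1))
        = κ / (w - 1) + mellin E (-w) := by
      have h3 : ∫ t in Set.Ioi (1 : ℝ), κ * (t : ℂ) ^ (-w) = κ / (w - 1) := by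
        rw [integral_const_mul, integral_Ioi_cpow_of_lt (by simpa using hw) one_pos]
        have : -w + 1 ≠ 0 := by
          contrapose! hw0; linear_combination -hw0
        simp
        field_simp
        ring
      rw [hmel, ← h3, ← integral_add hint1 hint2]
      refine setIntegral_congr_fun measurableSet_Ioi fun t ht => ?_
      have ht0 : (t : ℂ) ≠ 0 := by exact_mod_cast (lt_trans one_pos ht).ne'
      have e : (t : ℂ) ^ (-w) = t * (t : ℂ) ^ (-w - 1) := by
        rw [Complex.cpow_sub _ _ ht0, Complex.cpow_one]; field_simp
      simp only [hE, Set.indicator_of_mem ht, smul_eq_mul]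
      rw [e, show -(w + 1) = -w - 1 by ring]
      ring
    rw [h1, hG]
    field_simp
  have hEq : Set.EqOn F G {w : ℂ | 0 < w.re} := by
    refine AnalyticOnNhd.eqOn_of_preconnected_of_eventuallyEq (z₀ := 2)
      (fun w _ => hF.analyticAt w) (hGd.analyticOnNhd hopen)
      (convex_halfSpace_re_gt 0).isPreconnected (by simp) ?_
    filter_upwards [(isOpen_lt continuous_const Complex.continuous_re).mem_nhds
      (show (2 : ℂ) ∈ {w : ℂ | 1 < w.re} by simp)] with w hw using hGF w hw
  have hs0 : 0 < s.re := by linarith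
  rw [hEq hs0, hG]
  have hm : ‖mellin E (-s)‖ ≤ 2 * K := (hbd s hs0).trans (by
    rw [div_le_iff₀ hs0]; nlinarith)
  have hn1 : ‖s‖ ≤ |s.im| + 3 := (Complex.norm_le_abs_re_add_abs_im s).trans (by
    rw [abs_of_pos hs0]; linarith)
  have hn2 : ‖s - 1‖ ≤ |s.im| + 3 := (Complex.norm_le_abs_re_add_abs_im _).trans (by
    have : |s.re - 1| ≤ 3 := by rw [abs_le]; constructor <;> linarith
    simp only [sub_re, one_re, sub_im, one_im, sub_zero]
    linarith)
  have habs := abs_nonneg s.im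
  calc ‖κ * s + (s - 1) * s * mellin E (-s)‖
      ≤ ‖κ‖ * ‖s‖ + ‖s - 1‖ * ‖s‖ * ‖mellin E (-s)‖ := by
        refine (norm_add_le _ _).trans ?_
        rw [norm_mul, norm_mul, norm_mul]
    _ ≤ ‖κ‖ * (|s.im| + 3) ^ 2 + (|s.im| + 3) * (|s.im| + 3) * (2 * K) := by
        gcongr
        nlinarith
    _ = _ := by ring

/-- The entire function `(s - 1) ζ(s)`. -/
def zetaOne : ℂ → ℂ := DirichletCharacter.LFunctionTrivChar₁ 1

lemma differentiable_zetaOne : Differentiable ℂ zetaOne :=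
  DirichletCharacter.differentiable_LFunctionTrivChar₁ 1

lemma zetaOne_eq {s : ℂ} (hs : s ≠ 1) : zetaOne s = (s - 1) * riemannZeta s := by
  rw [zetaOne, DirichletCharacter.LFunctionTrivChar₁, Function.update_of_ne hs,
    DirichletCharacter.LFunctionTrivChar, DirichletCharacter.LFunction_modOne_eq]

lemma zetaOne_ne_zero {s : ℂ} (hs : 1 ≤ s.re) : zetaOne s ≠ 0 := by
  by_cases h : s = 1
  · rw [h]; exact DirichletCharacter.LFunctionTrivChar₁_apply_one_ne_zero 1
  · rw [zetaOne_eq h]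
    exact mul_ne_zero (sub_ne_zero.2 h) (riemannZeta_ne_zero_of_one_le_re hs)

lemma ne_one_of_one_lt_re {s : ℂ} (hs : 1 < s.re) : s ≠ 1 := by
  rintro rfl; simp at hs

lemma exists_norm_LSeries_le : ∃ C : ℝ, 1 ≤ C ∧ ∀ f : ℕ → ℂ, (∀ n, ‖f n‖ ≤ 1) →
    ∀ s : ℂ, 1 < s.re → s.re ≤ 2 → ‖LSeries f s‖ ≤ C / (s.re - 1) := by
  obtain ⟨C, hC⟩ := (isCompact_closedBall (0 : ℂ) 2).exists_bound_of_continuousOn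
    differentiable_zetaOne.continuous.continuousOn
  refine ⟨max C 1, le_max_right _ _, fun f hf s hs hs2 => ?_⟩
  set σ : ℂ := (s.re : ℂ) with hσ
  have hσ1 : 1 < σ.re := by simpa [hσ] using hs
  have hs1 : LSeriesSummable 1 s := LSeriesSummable_one_iff.2 hs
  have h1 : ∑' n, ‖LSeries.term 1 s n‖ = ‖riemannZeta σ‖ := by
    have : riemannZeta σ = ((∑' n, ‖LSeries.term 1 s n‖ : ℝ) : ℂ) := by
      rw [← LSeries_one_eq_riemannZeta hσ1, LSeries, Complex.ofReal_tsum]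
      refine tsum_congr fun n => ?_
      rw [LSeries.norm_term_eq, LSeries.term_def]
      split_ifs with h
      · simp
      · rw [hσ]
        push_cast
        rw [Complex.ofReal_cpow (Nat.cast_nonneg n)]
        simp
    rw [this, Complex.norm_real, Real.norm_eq_abs, abs_of_nonneg
        (tsum_nonneg fun _ => norm_nonneg _)]
  have h2 : ‖LSeries f s‖ ≤ ‖riemannZeta σ‖ := by
    rw [← h1]
    exact tsum_of_norm_bounded hs1.norm.hasSum
      fun n => LSeries.norm_term_le s (by simpa using hf n)
  have h3 : ‖riemannZeta σ‖ * (s.re - 1) = ‖zetaOne σ‖ := by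
    rw [zetaOne_eq (ne_one_of_one_lt_re hσ1), norm_mul, mul_comm]
    congr 1
    rw [hσ, show ((s.re : ℂ) - 1) = ((s.re - 1 : ℝ) : ℂ) by simp, Complex.norm_real,
      Real.norm_eq_abs, abs_of_pos (by linarith)]
  rw [le_div_iff₀ (by linarith)]
  calc ‖LSeries f s‖ * (s.re - 1) ≤ ‖riemannZeta σ‖ * (s.re - 1) := by
        have : 0 ≤ s.re - 1 := by linarith
        gcongr
    _ = ‖zetaOne σ‖ := h3
    _ ≤ C := hC σ (by
      rw [Metric.mem_closedBall, dist_zero_right, hσ, Complex.norm_real, Real.norm_eq_abs,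
        abs_of_pos (by linarith)]; exact hs2)
    _ ≤ _ := le_max_left _ _

lemma exists_stripBounds {N : ℕ} [NeZero N] (χ : DirichletCharacter ℂ N) {F : ℂ → ℂ} {κ : ℂ}
    {K : ℝ} (hF : Differentiable ℂ F)
    (hFs : ∀ s, s ≠ 1 → F s = (s - 1) * DirichletCharacter.LFunction χ s)
    (hK : ∀ t : ℝ, 1 ≤ t → ‖∑ k ∈ Finset.Icc 1 ⌊t⌋₊, χ k - κ * t‖ ≤ K) :
    ∃ C, StripBounds F C := by
  obtain ⟨C, hC1, hC⟩ := exists_norm_LSeries_le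
  have hχ1 : ∀ n : ℕ, ‖χ n‖ ≤ 1 := fun n => DirichletCharacter.norm_le_one χ _
  refine ⟨max C (‖κ‖ + 2 * K), hC1.trans (le_max_left _ _), hF, fun s h1 h2 => ?_, fun s hs => ?_,
    fun s h1 h2 h3 => ?_⟩
  · refine (norm_le_of_summatory hχ1 hK hF (fun w hw => ?_) s h1 h2).trans ?_
    · rw [hFs w (ne_one_of_one_lt_re hw), DirichletCharacter.LFunction_eq_LSeries _ hw]
    · gcongr
      exact le_max_right _ _
  · rw [hFs s (ne_one_of_one_lt_re hs)]
    exact mul_ne_zero (sub_ne_zero.2 (ne_one_of_one_lt_re hs))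
      (DirichletCharacter.LFunction_ne_zero_of_one_le_re χ (.inr (ne_one_of_one_lt_re hs)) hs.le)
  · have hmu := DirichletCharacter.LSeries.mul_mu_eq_one χ h1
    have hb := hC ((fun n : ℕ => χ n) * fun n => (ArithmeticFunction.moebius n : ℂ)) (fun n => by
      rw [Pi.mul_apply, norm_mul]
      refine mul_le_one₀ (hχ1 n) (norm_nonneg _) ?_
      rw [Complex.norm_intCast]
      exact_mod_cast ArithmeticFunction.abs_moebius_le_one) s h1 h2
    have hn := congrArg norm hmu
    rw [norm_mul, norm_one] at hn
    rw [hFs s (ne_one_of_one_lt_re h1), DirichletCharacter.LFunction_eq_LSeries _ h1, norm_mul]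
    have hs1 : 1 ≤ ‖s - 1‖ := by
      have := Complex.abs_im_le_norm (s - 1)
      simp at this
      linarith
    rw [le_div_iff₀ (by linarith)] at hb
    set A := ‖LSeries (fun n : ℕ => χ n) s‖
    have hA : 0 ≤ A := norm_nonneg _
    calc s.re - 1 = A * (‖LSeries ((fun n : ℕ => χ n) *
            fun n => (ArithmeticFunction.moebius n : ℂ)) s‖ * (s.re - 1)) := by
          rw [← mul_assoc, hn, one_mul]
      _ ≤ A * C := by gcongr
      _ = C * (1 * A) := by ring
      _ ≤ max C (‖κ‖ + 2 * K) * (‖s - 1‖ * A) := by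
          gcongr
          exact le_max_left _ _

lemma logDeriv_eq_sub_LSeries {N : ℕ} [NeZero N] (χ : DirichletCharacter ℂ N) {F : ℂ → ℂ}
    (hFs : ∀ s, s ≠ 1 → F s = (s - 1) * DirichletCharacter.LFunction χ s) {s : ℂ} (hs : 1 < s.re) :
    logDeriv F s = 1 / (s - 1) -
      LSeries ((fun n : ℕ => χ n) * fun n => (ArithmeticFunction.vonMangoldt n : ℂ)) s := by
  have hs1 := ne_one_of_one_lt_re hs
  have hFe : F =ᶠ[nhds s] fun w => (w - 1) * DirichletCharacter.LFunction χ w := by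
    filter_upwards [isOpen_ne.mem_nhds hs1] with w hw using hFs w hw
  have hLe : DirichletCharacter.LFunction χ =ᶠ[nhds s] LSeries (fun n : ℕ => χ n) := by
    filter_upwards [(isOpen_lt continuous_const Complex.continuous_re).mem_nhds
      (show s ∈ {w : ℂ | 1 < w.re} from hs)] with w hw
    exact DirichletCharacter.LFunction_eq_LSeries _ hw
  rw [logDeriv_apply, hFe.deriv_eq, hFe.eq_of_nhds, ← logDeriv_apply
    (fun w => (w - 1) * DirichletCharacter.LFunction χ w), logDeriv_mul (f := fun w : ℂ => w - 1) s
        (sub_ne_zero.2 hs1)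
      (DirichletCharacter.LFunction_ne_zero_of_one_le_re χ (.inr hs1) hs.le) (by fun_prop)
      (DirichletCharacter.differentiableAt_LFunction χ s (.inl hs1)),
    DirichletCharacter.LSeries_twist_vonMangoldt_eq χ hs, logDeriv_apply, logDeriv_apply,
    hLe.deriv_eq, hLe.eq_of_nhds]
  simp
  ring

lemma re_three_four_one_nonneg {N : ℕ} (χ : DirichletCharacter ℂ N)
    (hχ : ∀ n : ℕ, χ n = 0 ∨ χ n = 1 ∨ χ n = -1) {σ : ℝ} (hσ : 1 < σ) (t : ℝ) :
    0 ≤ 3 * (LSeries (fun n => (ArithmeticFunction.vonMangoldt n : ℂ)) σ).re +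
      4 * (LSeries ((fun n : ℕ => χ n) * fun n => (ArithmeticFunction.vonMangoldt n : ℂ))
        (σ + t * I)).re +
      (LSeries (fun n => (ArithmeticFunction.vonMangoldt n : ℂ)) (σ + 2 * t * I)).re := by
  have h1 := ArithmeticFunction.LSeriesSummable_vonMangoldt (s := (σ : ℂ)) (by simpa using hσ)
  have h2 := DirichletCharacter.LSeriesSummable_twist_vonMangoldt χ (s := σ + t * I)
    (by simpa using hσ)
  have h3 := ArithmeticFunction.LSeriesSummable_vonMangoldt (s := σ + 2 * t * I) (by simpa using hσ)
  rw [LSeries, LSeries, LSeries, Complex.re_tsum h1, Complex.re_tsum h2, Complex.re_tsum h3,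
    ← tsum_mul_left, ← tsum_mul_left]
  have g1 := (Complex.hasSum_re h1.hasSum).summable.mul_left 3
  have g2 := (Complex.hasSum_re h2.hasSum).summable.mul_left 4
  have g3 := (Complex.hasSum_re h3.hasSum).summable
  rw [← g1.tsum_add g2, ← (g1.add g2).tsum_add g3]
  refine tsum_nonneg fun n => ?_
  rcases eq_or_ne n 0 with rfl | hn
  · simp
  simp only [LSeries.term_of_ne_zero hn, Pi.mul_apply]
  have hn0 : (n : ℂ) ≠ 0 := by exact_mod_cast hn
  set u : ℂ := (n : ℂ) ^ (-(t * I)) with hu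
  set x : ℝ := ArithmeticFunction.vonMangoldt n / (n : ℝ) ^ σ with hx
  have hx0 : 0 ≤ x := by
    have := ArithmeticFunction.vonMangoldt_nonneg (n := n)
    positivity
  have hunorm : ‖u‖ = 1 := by
    rw [hu, Complex.norm_natCast_cpow_of_pos (Nat.pos_of_ne_zero hn)]
    simp
  have e1 : (ArithmeticFunction.vonMangoldt n : ℂ) / (n : ℂ) ^ (σ : ℂ) = x := by
    rw [hx]
    push_cast
    rw [Complex.ofReal_cpow (Nat.cast_nonneg n)]
    simp
  have e2 : χ n * (ArithmeticFunction.vonMangoldt n : ℂ) / (n : ℂ) ^ ((σ : ℂ) + t * I)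
      = x * (χ n * u) := by
    rw [← e1, Complex.cpow_add _ _ hn0, hu, Complex.cpow_neg]
    field_simp
  have e3 : (ArithmeticFunction.vonMangoldt n : ℂ) / (n : ℂ) ^ ((σ : ℂ) + 2 * t * I)
      = x * u ^ 2 := by
    rw [← e1, Complex.cpow_add _ _ hn0, hu, ← Complex.cpow_nat_mul, div_mul_eq_div_div,
      div_eq_mul_inv _ ((n : ℂ) ^ (2 * t * I)), ← Complex.cpow_neg]
    congr 2
    push_cast; ring
  rw [e1, e2, e3, Complex.re_ofReal_mul, Complex.re_ofReal_mul, Complex.ofReal_re]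
  have hsq : u.re ^ 2 + u.im ^ 2 = 1 := by
    have := Complex.sq_norm u
    rw [hunorm, Complex.normSq_apply] at this
    nlinarith
  have hu2 : (u ^ 2).re = 2 * u.re ^ 2 - 1 := by
    rw [sq, Complex.mul_re]; nlinarith
  rw [hu2]
  have key : 0 ≤ 3 + 4 * (χ n * u).re + (2 * u.re ^ 2 - 1) := by
    rcases hχ n with h | h | h <;> rw [h]
    · simp; nlinarith
    · simp; nlinarith [sq_nonneg (u.re + 1)]
    · simp; nlinarith [sq_nonneg (u.re - 1)]
  nlinarith

lemma zetaOne_eq_mul_LFunction (s : ℂ) (hs : s ≠ 1) :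
    zetaOne s = (s - 1) * DirichletCharacter.LFunction (1 : DirichletCharacter ℂ 1) s := by
  rw [zetaOne_eq hs, DirichletCharacter.LFunction_modOne_eq]

lemma logDeriv_zetaOne {s : ℂ} (hs : 1 < s.re) : logDeriv zetaOne s = 1 / (s - 1) -
    LSeries (fun n => (ArithmeticFunction.vonMangoldt n : ℂ)) s := by
  rw [logDeriv_eq_sub_LSeries 1 zetaOne_eq_mul_LFunction hs]
  congr 2
  ext n
  have : ((n : ℕ) : ZMod 1) = 1 := Subsingleton.elim _ _
  simp [this]

lemma exists_three_four_one {N : ℕ} [NeZero N] (χ : DirichletCharacter ℂ N)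
    (hχ : ∀ n : ℕ, χ n = 0 ∨ χ n = 1 ∨ χ n = -1) {F : ℂ → ℂ}
    (hFs : ∀ s, s ≠ 1 → F s = (s - 1) * DirichletCharacter.LFunction χ s) :
    ∃ C : ℝ, ∀ σ t : ℝ, 1 < σ → σ ≤ 2 → 1 ≤ |t| →
      4 * (logDeriv F (σ + t * I)).re + (logDeriv zetaOne (σ + 2 * t * I)).re
        ≤ 3 / (σ - 1) + C := by
  have hcont : ContinuousOn (fun σ : ℝ => logDeriv zetaOne σ) (Set.Icc 1 2) := by
    have : ContinuousOn (logDeriv zetaOne) {s | 1 ≤ s.re} := by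
      have hd : Continuous (deriv zetaOne) :=
        (differentiable_zetaOne.contDiff (n := 1)).continuous_deriv le_rfl
      exact hd.continuousOn.div differentiable_zetaOne.continuous.continuousOn
        fun s hs => zetaOne_ne_zero hs
    exact this.comp Complex.continuous_ofReal.continuousOn fun σ hσ => by simpa using hσ.1
  obtain ⟨C, hC⟩ := isCompact_Icc.exists_bound_of_continuousOn hcont
  refine ⟨3 * C + 5, fun σ t h1 h2 ht => ?_⟩
  have h := re_three_four_one_nonneg χ hχ h1 t
  have hσ := logDeriv_zetaOne (s := σ) (by simpa using h1)
  have hinv : ∀ s : ℂ, 1 ≤ |s.im| → (1 / (s - 1)).re ≤ 1 := by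
    intro s hs
    refine (Complex.re_le_norm _).trans ?_
    rw [norm_div, norm_one]
    have := Complex.abs_im_le_norm (s - 1)
    simp only [sub_im, one_im, sub_zero] at this
    exact div_le_one_of_le₀ (by linarith) (norm_nonneg _)
  have i1 := hinv (σ + t * I) (by simpa using ht)
  have i2 := hinv (σ + 2 * t * I) (by simp [abs_mul]; linarith)
  rw [logDeriv_eq_sub_LSeries χ hFs (by simpa using h1), logDeriv_zetaOne (by simpa using h1)]
  have h3 := (Complex.abs_re_le_norm _).trans (hC σ ⟨h1.le, h2⟩)
  rw [hσ, abs_le] at h3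
  have h4 : (1 / ((σ : ℂ) - 1)).re = 1 / (σ - 1) := by
    rw [← Complex.ofReal_one, ← Complex.ofReal_sub, ← Complex.ofReal_div, Complex.ofReal_re]
  rw [Complex.sub_re, h4] at h3
  rw [Complex.sub_re, Complex.sub_re]
  have : 3 / (σ - 1) = 3 * (1 / (σ - 1)) := by ring
  rw [this]
  linarith [h3.1]

/-- The nontrivial character modulo `4`, with complex values. -/
def chiFour : DirichletCharacter ℂ 4 := ZMod.χ₄.ringHomComp (Int.castRingHom ℂ)

lemma chiFour_apply (n : ℕ) : chiFour n = (ZMod.χ₄ n : ℂ) := by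
  simp [chiFour]

lemma chiFour_values (n : ℕ) : chiFour n = 0 ∨ chiFour n = 1 ∨ chiFour n = -1 := by
  rw [chiFour_apply]
  have : ∀ a : ZMod 4, ZMod.χ₄ a = 0 ∨ ZMod.χ₄ a = 1 ∨ ZMod.χ₄ a = -1 := by decide
  rcases this n with h | h | h <;> simp [h]

lemma chiFour_ne_one : chiFour ≠ 1 := by
  intro h
  have h3 : chiFour ((3 : ℕ) : ZMod 4) = (1 : DirichletCharacter ℂ 4) ((3 : ℕ) : ZMod 4) := by
    rw [h]
  rw [chiFour_apply, MulChar.one_apply (by decide), show ZMod.χ₄ ((3 : ℕ) : ZMod 4) = -1 by decide]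
    at h3
  norm_num at h3

lemma sum_chiFour (n : ℕ) : ∑ k ∈ Finset.Icc 1 n, ZMod.χ₄ (k : ZMod 4)
    = if n % 4 = 1 ∨ n % 4 = 2 then 1 else 0 := by
  induction n with
  | zero => simp
  | succ n ih =>
    rw [Finset.sum_Icc_succ_top (by omega), ih, ZMod.χ₄_nat_eq_if_mod_four]
    split_ifs <;> omega

/-- The entire function `(s - 1) L(s, χ₄)`. -/
def chiFourOne (s : ℂ) : ℂ := (s - 1) * DirichletCharacter.LFunction chiFour s

lemma differentiable_chiFourOne : Differentiable ℂ chiFourOne := by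
  have := DirichletCharacter.differentiable_LFunction chiFour_ne_one
  unfold chiFourOne
  fun_prop

lemma exists_stripBounds_zetaOne : ∃ C, StripBounds zetaOne C := by
  refine exists_stripBounds 1 (κ := 1) (K := 1) differentiable_zetaOne zetaOne_eq_mul_LFunction
    fun t ht => ?_
  have : ∑ k ∈ Finset.Icc 1 ⌊t⌋₊, (1 : DirichletCharacter ℂ 1) (k : ZMod 1) = (⌊t⌋₊ : ℂ) := by
    rw [Finset.sum_congr rfl (g := fun _ => (1 : ℂ))]
    · simp
    · intro k _
      have : ((k : ℕ) : ZMod 1) = 1 := Subsingleton.elim _ _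
      simp [this]
  rw [this, one_mul, show ((⌊t⌋₊ : ℂ) - t) = ((⌊t⌋₊ - t : ℝ) : ℂ) by simp, Complex.norm_real,
    Real.norm_eq_abs, abs_le]
  have h1 := Nat.floor_le (zero_le_one.trans ht)
  have h2 := Nat.lt_floor_add_one t
  constructor <;> linarith

lemma exists_stripBounds_chiFourOne : ∃ C, StripBounds chiFourOne C := by
  refine exists_stripBounds chiFour (κ := 0) (K := 1) differentiable_chiFourOne (fun _ _ => rfl)
    fun t _ => ?_
  rw [zero_mul, sub_zero, Finset.sum_congr rfl fun k _ => chiFour_apply k, ← Int.cast_sum,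
    sum_chiFour]
  split_ifs <;> simp

/-- Zero-free region and bound for the logarithmic derivatives of `ζ` and `L(·, χ₄)`, away from the
real axis. -/
lemma exists_logDeriv_bound_zetaOne_chiFourOne : ∃ a > 0, ∃ B, ∀ s : ℂ, 2 ≤ |s.im| →
    1 - a / Real.log (|s.im| + 3) ≤ s.re → s.re ≤ 2 →
      (zetaOne s ≠ 0 ∧ chiFourOne s ≠ 0) ∧ ‖logDeriv zetaOne s‖ ≤ B * Real.log (|s.im| + 3) ^ 2 ∧
        ‖logDeriv chiFourOne s‖ ≤ B * Real.log (|s.im| + 3) ^ 2 := by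
  obtain ⟨C1, hZ⟩ := exists_stripBounds_zetaOne
  obtain ⟨C2, hL⟩ := exists_stripBounds_chiFourOne
  obtain ⟨C3, h3⟩ := exists_three_four_one (1 : DirichletCharacter ℂ 1) (fun n => .inr (.inl (by
    have : ((n : ℕ) : ZMod 1) = 1 := Subsingleton.elim _ _
    simp [this]))) zetaOne_eq_mul_LFunction
  obtain ⟨C4, h4⟩ := exists_three_four_one chiFour chiFour_values (F := chiFourOne) fun _ _ => rfl
  set C := max (max C1 C2) (max C3 C4)
  have l1 : C1 ≤ C := (le_max_left _ _).trans (le_max_left _ _)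
  have l2 : C2 ≤ C := (le_max_right _ _).trans (le_max_left _ _)
  have l3 : C3 ≤ C := (le_max_left _ _).trans (le_max_right _ _)
  have l4 : C4 ≤ C := (le_max_right _ _).trans (le_max_right _ _)
  obtain ⟨a1, ha1, B1, hB1⟩ := exists_logDeriv_bound (hZ.mono l1) (hZ.mono l1)
    fun σ t h h' ht => (h3 σ t h h' ht).trans (by linarith)
  obtain ⟨a2, ha2, B2, hB2⟩ := exists_logDeriv_bound (hL.mono l2) (hZ.mono l1)
    fun σ t h h' ht => (h4 σ t h h' ht).trans (by linarith)
  refine ⟨min a1 a2, lt_min ha1 ha2, max B1 B2, fun s hs hre hre2 => ?_⟩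
  have hℓ := one_le_log_abs_add_three s.im
  have e1 : min a1 a2 / Real.log (|s.im| + 3) ≤ a1 / Real.log (|s.im| + 3) := by
    gcongr; exact min_le_left _ _
  have e2 : min a1 a2 / Real.log (|s.im| + 3) ≤ a2 / Real.log (|s.im| + 3) := by
    gcongr; exact min_le_right _ _
  obtain ⟨u1, v1⟩ := hB1 s hs (by linarith) hre2
  obtain ⟨u2, v2⟩ := hB2 s hs (by linarith) hre2
  refine ⟨⟨u1, u2⟩, v1.trans ?_, v2.trans ?_⟩
  · gcongr; exact le_max_left _ _
  · gcongr; exact le_max_right _ _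

/-- The coefficients `Λ(n) (1 - χ₄(n)) - 1`. -/
def inertCoeff (n : ℕ) : ℂ :=
  ArithmeticFunction.vonMangoldt n - chiFour n * ArithmeticFunction.vonMangoldt n - 1

/-- The analytic continuation of the Dirichlet series with coefficients `inertCoeff`. -/
def inertSeries (s : ℂ) : ℂ :=
  -logDeriv zetaOne s - dslope zetaOne 1 s + logDeriv (DirichletCharacter.LFunction chiFour) s

lemma inertCoeff_eq : inertCoeff = (fun n => (ArithmeticFunction.vonMangoldt n : ℂ)) -
    ((fun n : ℕ => chiFour n) * fun n => (ArithmeticFunction.vonMangoldt n : ℂ)) - 1 := by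
  ext n; simp [inertCoeff]

lemma LSeriesSummable_inertCoeff {s : ℂ} (hs : 1 < s.re) : LSeriesSummable inertCoeff s := by
  rw [inertCoeff_eq]
  exact ((ArithmeticFunction.LSeriesSummable_vonMangoldt hs).sub
    (DirichletCharacter.LSeriesSummable_twist_vonMangoldt chiFour hs)).sub
      (LSeriesSummable_one_iff.2 hs)

lemma zetaOne_one : zetaOne 1 = 1 := by
  simp [zetaOne, DirichletCharacter.LFunctionTrivChar₁]

lemma logDeriv_chiFourOne {s : ℂ} (hs : s ≠ 1)
    (hL : DirichletCharacter.LFunction chiFour s ≠ 0) :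
    logDeriv chiFourOne s
      = 1 / (s - 1) + logDeriv (DirichletCharacter.LFunction chiFour) s := by
  have : chiFourOne = fun w => (w - 1) * DirichletCharacter.LFunction chiFour w := rfl
  rw [this, logDeriv_mul (f := fun w : ℂ => w - 1) s (sub_ne_zero.2 hs) hL (by fun_prop)
    (DirichletCharacter.differentiable_LFunction chiFour_ne_one s), logDeriv_apply (fun w => w - 1)]
  simp

lemma inertSeries_eq_LSeries {s : ℂ} (hs : 1 < s.re) : inertSeries s = LSeries inertCoeff s := by
  have hs1 := ne_one_of_one_lt_re hs
  have h1 := ArithmeticFunction.LSeriesSummable_vonMangoldt hs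
  have h2 := DirichletCharacter.LSeriesSummable_twist_vonMangoldt chiFour hs
  rw [inertCoeff_eq, LSeries_sub (h1.sub h2) (LSeriesSummable_one_iff.2 hs), LSeries_sub h1 h2,
    LSeries_one_eq_riemannZeta hs, inertSeries, logDeriv_zetaOne hs, dslope_of_ne _ hs1,
    slope_def_field, zetaOne_one, zetaOne_eq hs1]
  have h3 := logDeriv_chiFourOne hs1 (DirichletCharacter.LFunction_ne_zero_of_one_le_re chiFour
    (.inr hs1) hs.le)
  rw [logDeriv_eq_sub_LSeries chiFour (F := chiFourOne) (fun _ _ => rfl) hs] at h3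
  have h4 : s - 1 ≠ 0 := sub_ne_zero.2 hs1
  have h5 : ((s - 1) * riemannZeta s - 1) / (s - 1) = riemannZeta s - 1 / (s - 1) := by
    field_simp
  rw [h5]
  linear_combination -h3

lemma differentiable_dslope_zetaOne : Differentiable ℂ (dslope zetaOne 1) := by
  rw [← differentiableOn_univ, Complex.differentiableOn_dslope Filter.univ_mem]
  exact differentiable_zetaOne.differentiableOn

lemma differentiableAt_logDeriv {f : ℂ → ℂ} (hf : Differentiable ℂ f) {s : ℂ} (hs : f s ≠ 0) :
    DifferentiableAt ℂ (logDeriv f) s := by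
  have : DifferentiableAt ℂ (deriv f) s := hf.contDiff.differentiable_deriv_two s
  exact this.div (hf s) hs

lemma differentiableAt_inertSeries {s : ℂ} (h1 : zetaOne s ≠ 0)
    (h2 : DirichletCharacter.LFunction chiFour s ≠ 0) : DifferentiableAt ℂ inertSeries s :=
  ((differentiableAt_logDeriv differentiable_zetaOne h1).neg.sub
    (differentiable_dslope_zetaOne s)).add
      (differentiableAt_logDeriv (DirichletCharacter.differentiable_LFunction chiFour_ne_one) h2)

lemma exists_inertSeries_bound_low : ∃ ε > 0, ∃ C, ∀ s : ℂ, |s.im| ≤ 2 → 1 - ε ≤ s.re → s.re ≤ 2 →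
    DifferentiableAt ℂ inertSeries s ∧ ‖inertSeries s‖ ≤ C := by
  have hL := DirichletCharacter.differentiable_LFunction chiFour_ne_one
  set U : Set ℂ := {s | zetaOne s ≠ 0 ∧ DirichletCharacter.LFunction chiFour s ≠ 0} with hU
  have hUo : IsOpen U := (isOpen_ne_fun differentiable_zetaOne.continuous continuous_const).inter
    (isOpen_ne_fun hL.continuous continuous_const)
  have hK : IsCompact (Set.Icc (1 : ℝ) 2 ×ℂ Set.Icc (-2 : ℝ) 2) :=
    isCompact_Icc.reProdIm isCompact_Icc
  have hKU : (Set.Icc (1 : ℝ) 2 ×ℂ Set.Icc (-2 : ℝ) 2) ⊆ U := fun s hs =>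
    ⟨zetaOne_ne_zero hs.1.1, DirichletCharacter.LFunction_ne_zero_of_one_le_re chiFour
      (.inl chiFour_ne_one) hs.1.1⟩
  obtain ⟨ε, hε, hεU⟩ := hK.exists_cthickening_subset_open hUo hKU
  have hsub : Set.Icc (1 - ε) 2 ×ℂ Set.Icc (-2 : ℝ) 2 ⊆ U := by
    intro s hs
    apply hεU
    refine Metric.mem_cthickening_of_dist_le s ((max s.re 1 : ℝ) + s.im * I) ε _ ?_ ?_
    · have h1 := hs.1.2
      refine ⟨?_, ?_⟩
      · simp [h1]
      · simpa using hs.2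
    · rw [dist_eq_norm]
      have h1 := hs.1.1
      have : s - ((max s.re 1 : ℝ) + s.im * I) = ((s.re - max s.re 1 : ℝ) : ℂ) := by
        apply Complex.ext <;> simp
      rw [this, Complex.norm_real, Real.norm_eq_abs, abs_le]
      rcases max_cases s.re 1 with ⟨h, h'⟩ | ⟨h, h'⟩ <;> rw [h] <;> constructor <;> linarith
  have hd : ∀ s ∈ Set.Icc (1 - ε) 2 ×ℂ Set.Icc (-2 : ℝ) 2, DifferentiableAt ℂ inertSeries s :=
    fun s hs => differentiableAt_inertSeries (hsub hs).1 (hsub hs).2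
  obtain ⟨C, hC⟩ := (isCompact_Icc.reProdIm isCompact_Icc).exists_bound_of_continuousOn
    fun s hs => (hd s hs).continuousAt.continuousWithinAt
  refine ⟨ε, hε, C, fun s h1 h2 h3 => ?_⟩
  have hs : s ∈ Set.Icc (1 - ε) 2 ×ℂ Set.Icc (-2 : ℝ) 2 := ⟨⟨h2, h3⟩, abs_le.1 h1⟩
  exact ⟨hd s hs, hC s hs⟩

lemma exists_inertSeries_bound : ∃ c > 0, c ≤ 1 / 2 ∧ ∃ C, 0 ≤ C ∧ ∀ s : ℂ,
    1 - c / Real.log (|s.im| + 3) ≤ s.re → s.re ≤ 2 →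
      DifferentiableAt ℂ inertSeries s ∧ ‖inertSeries s‖ ≤ C * (|s.im| + 3) ^ 2 := by
  obtain ⟨ε, hε, C1, h1⟩ := exists_inertSeries_bound_low
  obtain ⟨a, ha, B, h2⟩ := exists_logDeriv_bound_zetaOne_chiFourOne
  obtain ⟨C2, h3⟩ := exists_stripBounds_zetaOne
  refine ⟨min (min ε a) (1 / 2), by positivity, min_le_right _ _,
    max C1 0 + (2 * max B 0 + C2 + 2), ?_, fun s hre hre2 => ?_⟩
  · have := h3.one_le
    positivity
  have hℓ := one_le_log_abs_add_three s.im
  have hC2 := h3.one_le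
  have habs := abs_nonneg s.im
  set ℓ := Real.log (|s.im| + 3) with hℓdef
  have hm : min (min ε a) (1 / 2) / ℓ ≤ min (min ε a) (1 / 2) :=
    div_le_self (by positivity) hℓ
  have hE : 1 ≤ (|s.im| + 3) ^ 2 := by nlinarith
  rcases le_total |s.im| 2 with ht | ht
  · have : min (min ε a) (1 / 2) ≤ ε := (min_le_left _ _).trans (min_le_left _ _)
    obtain ⟨d, b⟩ := h1 s ht (by linarith) hre2
    refine ⟨d, b.trans ?_⟩
    calc C1 ≤ max C1 0 * 1 := by rw [mul_one]; exact le_max_left _ _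
      _ ≤ (max C1 0 + (2 * max B 0 + C2 + 2)) * (|s.im| + 3) ^ 2 := by
        gcongr
        have : 0 ≤ max B 0 := le_max_right _ _
        linarith
  · have : min (min ε a) (1 / 2) / ℓ ≤ a / ℓ := by
      gcongr
      exact (min_le_left _ _).trans (min_le_right _ _)
    obtain ⟨⟨d1, d2⟩, b1, b2⟩ := h2 s ht (by linarith) hre2
    have hL : DirichletCharacter.LFunction chiFour s ≠ 0 := right_ne_zero_of_mul d2
    have hs1 : s ≠ 1 := by
      rintro rfl; simp at ht; linarith
    refine ⟨differentiableAt_inertSeries d1 hL, ?_⟩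
    have hn : 1 ≤ ‖s - 1‖ := by
      have := Complex.abs_im_le_norm (s - 1)
      simp at this
      linarith
    have hinv : ‖1 / (s - 1)‖ ≤ 1 := by
      rw [norm_div, norm_one]
      exact div_le_one_of_le₀ hn (norm_nonneg _)
    have hlE : ℓ ^ 2 ≤ (|s.im| + 3) ^ 2 := by
      gcongr
      exact (Real.log_le_sub_one_of_pos (by positivity)).trans (by linarith)
    have hBl : B * ℓ ^ 2 ≤ max B 0 * (|s.im| + 3) ^ 2 := by
      have := le_max_right B 0
      gcongr
      exact le_max_left _ _
    have hdsl : ‖dslope zetaOne 1 s‖ ≤ C2 * (|s.im| + 3) ^ 2 + 1 := by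
      have hz := h3.upper s (by linarith [min_le_right (min ε a) (1 / 2 : ℝ)]) (by linarith)
      rw [dslope_of_ne _ hs1, slope_def_field, zetaOne_one, norm_div]
      refine (div_le_self (norm_nonneg _) hn).trans ((norm_sub_le _ _).trans ?_)
      simpa using hz
    have e : inertSeries s = -logDeriv zetaOne s - dslope zetaOne 1 s
        + (logDeriv chiFourOne s - 1 / (s - 1)) := by
      rw [logDeriv_chiFourOne hs1 hL, inertSeries]; ring
    rw [e]
    have n1 := norm_add_le (-logDeriv zetaOne s - dslope zetaOne 1 s)
      (logDeriv chiFourOne s - 1 / (s - 1))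
    have n2 := norm_sub_le (-logDeriv zetaOne s) (dslope zetaOne 1 s)
    have n3 := norm_sub_le (logDeriv chiFourOne s) (1 / (s - 1))
    rw [norm_neg] at n2
    have hC1 : 0 ≤ max C1 0 * (|s.im| + 3) ^ 2 := by positivity
    nlinarith

lemma mellinConvergent_of_hasCompactSupport {g : ℝ → ℂ} (hg : Continuous g)
    (hc : HasCompactSupport g) {s : ℂ} (hs : 0 < s.re) : MellinConvergent g s := by
  refine mellinConvergent_of_isBigO_rpow (a := s.re + 1) (b := 0)
    (hg.locallyIntegrable.locallyIntegrableOn _) ?_ (by linarith) ?_ hs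
  · refine IsBigO.of_bound 0 ?_
    obtain ⟨R, hR⟩ := hc.isCompact.bddAbove
    filter_upwards [eventually_gt_atTop R] with x hx
    rw [image_eq_zero_of_notMem_tsupport fun h => absurd (hR h) (not_le.2 hx)]
    simp
  · simp only [neg_zero, Real.rpow_zero]
    exact (hg.continuousAt.tendsto.isBigO_one ℝ).mono nhdsWithin_le_nhds

lemma differentiableAt_mellin_of_hasCompactSupport {g : ℝ → ℂ} (hg : Continuous g)
    (hc : HasCompactSupport g) {s : ℂ} (hs : 0 < s.re) : DifferentiableAt ℂ (mellin g) s := by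
  refine mellin_differentiableAt_of_isBigO_rpow (a := s.re + 1) (b := 0)
    (hg.locallyIntegrable.locallyIntegrableOn _) ?_ (by linarith) ?_ hs
  · refine IsBigO.of_bound 0 ?_
    obtain ⟨R, hR⟩ := hc.isCompact.bddAbove
    filter_upwards [eventually_gt_atTop R] with x hx
    rw [image_eq_zero_of_notMem_tsupport fun h => absurd (hR h) (not_le.2 hx)]
    simp
  · simp only [neg_zero, Real.rpow_zero]
    exact (hg.continuousAt.tendsto.isBigO_one ℝ).mono nhdsWithin_le_nhds

lemma mul_mellin_eq_neg_mellin_deriv {g : ℝ → ℂ} (hg : ContDiff ℝ 1 g)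
    (hc : HasCompactSupport g) {s : ℂ} (hs : 0 < s.re) :
    s * mellin g s = -mellin (deriv g) (s + 1) := by
  have hs0 : s ≠ 0 := by rintro rfl; simp at hs
  have hg' : Continuous (deriv g) := hg.continuous_deriv le_rfl
  have i1 : IntegrableOn (fun x : ℝ => s * ((x : ℂ) ^ (s - 1) • g x)) (Set.Ioi 0) :=
    (mellinConvergent_of_hasCompactSupport hg.continuous hc hs).const_mul s
  have i2 : IntegrableOn (fun x : ℝ => (x : ℂ) ^ (s + 1 - 1) • deriv g x) (Set.Ioi 0) :=
    mellinConvergent_of_hasCompactSupport hg' hc.deriv (by simp; linarith)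
  have h := integral_Ioi_of_hasDerivAt_of_tendsto (f := fun x : ℝ => (x : ℂ) ^ s * g x)
    (f' := fun x : ℝ => s * ((x : ℂ) ^ (s - 1) • g x) + (x : ℂ) ^ (s + 1 - 1) • deriv g x)
    (a := 0) (m := 0) ?_ ?_ (i1.add i2) ?_
  · rw [integral_add i1 i2, integral_const_mul] at h
    simp only [Complex.ofReal_zero, Complex.zero_cpow hs0, zero_mul, sub_zero] at h
    rw [mellin, mellin]
    exact eq_neg_of_add_eq_zero_left h
  · refine ContinuousAt.continuousWithinAt (ContinuousAt.mul ?_ hg.continuous.continuousAt)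
    exact Complex.continuousAt_ofReal_cpow_const 0 s (.inl hs)
  · intro x hx
    have hx0 : x ≠ 0 := ne_of_gt hx
    have h1 := hasDerivAt_ofReal_cpow_const' hx0 (r := s - 1) (by
      intro h; apply hs0; linear_combination h)
    have h2 : HasDerivAt (fun y : ℝ => (y : ℂ) ^ s) (s * (x : ℂ) ^ (s - 1)) x := by
      have := h1.const_mul s
      simp only [sub_add_cancel] at this
      refine this.congr_of_eventuallyEq (Eventually.of_forall fun y => ?_)
      field_simp
    have h3 := h2.mul (hg.differentiable one_ne_zero x).hasDerivAt
    refine h3.congr_deriv ?_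
    simp only [smul_eq_mul, add_sub_cancel_right]
    ring
  · refine tendsto_const_nhds.congr' ?_
    obtain ⟨R, hR⟩ := hc.isCompact.bddAbove
    filter_upwards [eventually_gt_atTop R] with x hx
    rw [image_eq_zero_of_notMem_tsupport fun h => absurd (hR h) (not_le.2 hx), mul_zero]

lemma exists_norm_mellin_le {g : ℝ → ℂ} (hg : Continuous g) (hc : HasCompactSupport g) (A : ℝ) :
    ∃ C, 0 ≤ C ∧ ∀ s : ℂ, 1 / 2 ≤ s.re → s.re ≤ A → ‖mellin g s‖ ≤ C := by
  obtain ⟨M, hM⟩ := hc.exists_bound_of_continuous hg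
  obtain ⟨R, hR⟩ := hc.isCompact.bddAbove
  set R' := max R 1
  have hR1 : 1 ≤ R' := le_max_right _ _
  have hM0 : 0 ≤ M := (norm_nonneg _).trans (hM 0)
  refine ⟨2 * M * R' ^ A, by positivity, fun s h1 h2 => ?_⟩
  have hs : 0 < s.re := by linarith
  have e : mellin g s = ∫ x in Set.Ioc 0 R', (x : ℂ) ^ (s - 1) • g x := by
    rw [mellin]
    refine (setIntegral_eq_of_subset_of_forall_sdiff_eq_zero measurableSet_Ioi
      Set.Ioc_subset_Ioi_self fun x hx => ?_)
    have : R < x := by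
      by_contra h
      exact hx.2 ⟨hx.1, (not_lt.1 h).trans (le_max_left _ _)⟩
    rw [image_eq_zero_of_notMem_tsupport fun h => absurd (hR h) (not_le.2 this), smul_zero]
  rw [e]
  have hint : IntegrableOn (fun x : ℝ => M * x ^ (s.re - 1)) (Set.Ioc 0 R') :=
    ((intervalIntegrable_iff_integrableOn_Ioc_of_le (by linarith)).1
      (intervalIntegral.intervalIntegrable_rpow' (by linarith))).const_mul M
  have hval : ∫ x in Set.Ioc 0 R', M * x ^ (s.re - 1) = M * R' ^ s.re / s.re := by
    rw [integral_const_mul, ← intervalIntegral.integral_of_le (by linarith),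
      integral_rpow (.inl (by linarith)), sub_add_cancel, Real.zero_rpow hs.ne', sub_zero]
    ring
  calc ‖∫ x in Set.Ioc 0 R', (x : ℂ) ^ (s - 1) • g x‖
      ≤ ∫ x in Set.Ioc 0 R', M * x ^ (s.re - 1) := by
        refine norm_integral_le_of_norm_le hint ?_
        filter_upwards [ae_restrict_mem measurableSet_Ioc] with x hx
        have hx0 : 0 < x := hx.1
        rw [norm_smul, Complex.norm_cpow_eq_rpow_re_of_pos hx0, mul_comm]
        simp only [sub_re, one_re]
        gcongr
        exact hM x
    _ = M * R' ^ s.re / s.re := hval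
    _ ≤ M * R' ^ A / (1 / 2) := by gcongr
    _ = _ := by ring

lemma exists_mellin_decay (k : ℕ) : ∀ {g : ℝ → ℂ}, ContDiff ℝ k g → HasCompactSupport g →
    ∀ A : ℝ, ∃ C, 0 ≤ C ∧ ∀ s : ℂ, 1 / 2 ≤ s.re → s.re ≤ A →
      ‖mellin g s‖ ≤ C / (|s.im| + 1) ^ k := by
  induction k with
  | zero =>
    intro g hg hc A
    simpa using exists_norm_mellin_le hg.continuous hc A
  | succ k ih =>
    intro g hg hc A
    have hg1 : ContDiff ℝ 1 g := hg.of_le (by exact_mod_cast Nat.le_add_left 1 k)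
    have hg' : ContDiff ℝ k (deriv g) := by
      have : ContDiff ℝ ((k : WithTop ℕ∞) + 1) g := by exact_mod_cast hg
      exact (contDiff_succ_iff_deriv.1 this).2.2
    obtain ⟨C, hC0, hC⟩ := ih hg' hc.deriv (A + 1)
    refine ⟨3 * C, by positivity, fun s h1 h2 => ?_⟩
    have h := congrArg norm (mul_mellin_eq_neg_mellin_deriv hg1 hc (s := s) (by linarith))
    rw [norm_mul, norm_neg] at h
    have hb := hC (s + 1) (by simp; linarith) (by simpa using h2)
    rw [← h] at hb
    simp only [add_im, one_im, add_zero] at hb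
    have n1 := (le_abs_self _).trans (Complex.abs_re_le_norm s)
    have n2 := Complex.abs_im_le_norm s
    have habs := abs_nonneg s.im
    rw [le_div_iff₀ (by positivity)] at hb ⊢
    have : |s.im| + 1 ≤ 3 * ‖s‖ := by linarith
    calc ‖mellin g s‖ * (|s.im| + 1) ^ (k + 1)
        = ‖mellin g s‖ * (|s.im| + 1) ^ k * (|s.im| + 1) := by ring
      _ ≤ ‖mellin g s‖ * (|s.im| + 1) ^ k * (3 * ‖s‖) := by gcongr
      _ = 3 * (‖s‖ * ‖mellin g s‖ * (|s.im| + 1) ^ k) := by ring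
      _ ≤ 3 * C := by gcongr

lemma norm_setIntegral_le_pi_mul {f : ℝ → ℂ} {S : Set ℝ} {A : ℝ} (hS : MeasurableSet S)
    (hA : 0 ≤ A) (hf : ∀ t ∈ S, ‖f t‖ ≤ A * (1 + t ^ 2)⁻¹) : ‖∫ t in S, f t‖ ≤ π * A := by
  have hi : Integrable fun t : ℝ => A * (1 + t ^ 2)⁻¹ := integrable_inv_one_add_sq.const_mul A
  calc ‖∫ t in S, f t‖ ≤ ∫ t in S, A * (1 + t ^ 2)⁻¹ :=
        norm_integral_le_of_norm_le hi.integrableOn (by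
          filter_upwards [ae_restrict_mem hS] with t ht using hf t ht)
    _ ≤ ∫ t : ℝ, A * (1 + t ^ 2)⁻¹ :=
        setIntegral_le_integral hi (Eventually.of_forall fun t => by positivity)
    _ = π * A := by rw [integral_const_mul, integral_univ_inv_one_add_sq, mul_comm]

/-- Shifting a vertical line of integration to the left inside a truncated strip. -/
lemma norm_integral_vertical_le {H : ℂ → ℂ} {σ₀ σ₁ T A B : ℝ} (hσ : σ₀ ≤ σ₁) (hT : 0 ≤ T)
    (hA : 0 ≤ A) (hB : 0 ≤ B)
    (hd : ∀ s : ℂ, σ₀ ≤ s.re → s.re ≤ σ₁ → |s.im| ≤ T → DifferentiableAt ℂ H s)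
    (hleft : ∀ t : ℝ, |t| ≤ T → ‖H (σ₀ + t * I)‖ ≤ A * (1 + t ^ 2)⁻¹)
    (hhor : ∀ s : ℂ, σ₀ ≤ s.re → s.re ≤ σ₁ → |s.im| = T → ‖H s‖ ≤ B)
    (hright : ∀ t : ℝ, T ≤ |t| → ‖H (σ₁ + t * I)‖ ≤ B * (1 + t ^ 2)⁻¹)
    (hint : Integrable fun t : ℝ => H (σ₁ + t * I)) :
    ‖∫ t : ℝ, H (σ₁ + t * I)‖ ≤ π * A + (2 * (σ₁ - σ₀) + π) * B := by
  have hrect := Complex.integral_boundary_rect_eq_zero_of_differentiableOn H (σ₀ - T * I)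
    (σ₁ + T * I) (by
      intro s hs
      have h1 := hs.1
      have h2 := hs.2
      simp only [Set.mem_preimage, sub_re, ofReal_re, mul_re, I_re, mul_zero, ofReal_im, I_im,
        mul_one, sub_self, sub_zero, add_re, add_zero, Set.uIcc_of_le hσ] at h1
      simp only [Set.mem_preimage, sub_im, ofReal_im, mul_im, ofReal_re, I_im, mul_one, I_re,
        mul_zero, add_zero, zero_sub, add_im, zero_add,
        Set.uIcc_of_le (show -T ≤ T by linarith)] at h2
      exact (hd s h1.1 h1.2 (abs_le.2 h2)).differentiableWithinAt)
  simp only [sub_re, ofReal_re, mul_re, I_re, mul_zero, ofReal_im, I_im, mul_one, sub_self,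
    sub_zero, add_re, add_zero, sub_im, mul_im, zero_sub, add_im, zero_add] at hrect
  set J1 := ∫ x : ℝ in σ₀..σ₁, H (x + (-T : ℝ) * I)
  set J2 := ∫ x : ℝ in σ₀..σ₁, H (x + T * I)
  set V1 := ∫ y : ℝ in (-T)..T, H (σ₁ + y * I) with hV1
  set V0 := ∫ y : ℝ in (-T)..T, H (σ₀ + y * I) with hV0
  have b1 : ‖J1‖ ≤ B * (σ₁ - σ₀) := by
    have := intervalIntegral.norm_integral_le_of_norm_le_const (C := B)
      (f := fun x : ℝ => H (x + (-T : ℝ) * I)) (a := σ₀) (b := σ₁) (fun x hx => by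
        rw [Set.uIoc_of_le hσ] at hx
        exact hhor _ (by simpa using hx.1.le) (by simpa using hx.2) (by simp [abs_of_nonneg hT]))
    rwa [abs_of_nonneg (by linarith)] at this
  have b2 : ‖J2‖ ≤ B * (σ₁ - σ₀) := by
    have := intervalIntegral.norm_integral_le_of_norm_le_const (C := B)
      (f := fun x : ℝ => H (x + T * I)) (a := σ₀) (b := σ₁) (fun x hx => by
        rw [Set.uIoc_of_le hσ] at hx
        exact hhor _ (by simpa using hx.1.le) (by simpa using hx.2) (by simp [abs_of_nonneg hT]))
    rwa [abs_of_nonneg (by linarith)] at this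
  have b0 : ‖V0‖ ≤ π * A := by
    rw [hV0, intervalIntegral.integral_of_le (by linarith)]
    exact norm_setIntegral_le_pi_mul measurableSet_Ioc hA
      fun t ht => hleft t (abs_le.2 ⟨ht.1.le, ht.2⟩)
  have b3 : ‖∫ t in (Set.Ioc (-T) T)ᶜ, H (σ₁ + t * I)‖ ≤ π * B := by
    refine norm_setIntegral_le_pi_mul measurableSet_Ioc.compl hB fun t ht => hright t ?_
    by_contra h
    push Not at h
    rw [abs_lt] at h
    exact ht ⟨h.1, h.2.le⟩
  have b4 : ‖V1‖ ≤ π * A + 2 * (σ₁ - σ₀) * B := by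
    have e : I • V1 = I • V0 + J2 - J1 := by linear_combination hrect
    have hn : ‖V1‖ = ‖I • V1‖ := by rw [norm_smul, Complex.norm_I, one_mul]
    rw [hn, e]
    have n1 := norm_sub_le (I • V0 + J2) J1
    have n2 := norm_add_le (I • V0) J2
    rw [norm_smul, Complex.norm_I, one_mul] at n2
    linarith
  rw [← integral_add_compl (measurableSet_Ioc (a := -T) (b := T)) hint,
    ← intervalIntegral.integral_of_le (by linarith)]
  refine (norm_add_le _ _).trans ?_
  linarith

lemma norm_term_vertical (a : ℕ → ℂ) (σ t : ℝ) (n : ℕ) :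
    ‖LSeries.term a (σ + t * I) n‖ = ‖LSeries.term a σ n‖ := by
  simp [LSeries.norm_term_eq]

/-- A smoothed sum of Dirichlet coefficients as a vertical integral. -/
lemma tsum_mul_eq_integral {a : ℕ → ℂ} {g : ℝ → ℂ} {σ Y : ℝ} (hσ : 0 < σ) (hY : 0 < Y)
    (ha : LSeriesSummable a σ) (hg : Continuous g) (hc : HasCompactSupport g) (hg0 : g 0 = 0)
    (hv : Integrable fun t : ℝ => mellin g (σ + t * I)) :
    Integrable (fun t : ℝ => LSeries a (σ + t * I) *
        (mellin g (σ + t * I) * (Y : ℂ) ^ ((σ : ℂ) + t * I))) ∧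
    ∑' n : ℕ, a n * g (n / Y) = (1 / (2 * π) : ℂ) * ∫ t : ℝ, LSeries a (σ + t * I) *
        (mellin g (σ + t * I) * (Y : ℂ) ^ ((σ : ℂ) + t * I)) := by
  have hYc : (Y : ℂ) ≠ 0 := by exact_mod_cast hY.ne'
  set W : ℝ → ℂ := fun t => mellin g (σ + t * I) * (Y : ℂ) ^ ((σ : ℂ) + t * I) with hW
  have hYn : ∀ t : ℝ, ‖(Y : ℂ) ^ ((σ : ℂ) + t * I)‖ = Y ^ σ := fun t => by
    rw [Complex.norm_cpow_eq_rpow_re_of_pos hY]; simp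
  have hYcont : Continuous fun t : ℝ => (Y : ℂ) ^ ((σ : ℂ) + t * I) :=
    Continuous.const_cpow (by fun_prop) (.inl hYc)
  have hWi : Integrable W := by
    refine hv.mul_bdd (c := Y ^ σ) hYcont.aestronglyMeasurable
      (Eventually.of_forall fun t => (hYn t).le)
  have htc : ∀ n, Continuous fun t : ℝ => LSeries.term a (σ + t * I) n := by
    intro n
    rcases eq_or_ne n 0 with rfl | hn
    · simpa using continuous_const
    · have hn0 : (n : ℂ) ≠ 0 := by exact_mod_cast hn
      simp only [LSeries.term_of_ne_zero hn]
      refine continuous_const.div (Continuous.const_cpow (by fun_prop) (.inl hn0)) fun t => ?_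
      rw [Complex.cpow_ne_zero_iff]
      exact .inl hn0
  have hFi : ∀ n, Integrable fun t : ℝ => LSeries.term a (σ + t * I) n * W t := fun n =>
    hWi.bdd_mul (c := ‖LSeries.term a σ n‖) (htc n).aestronglyMeasurable
      (Eventually.of_forall fun t => (norm_term_vertical a σ t n).le)
  have hFn : ∀ n, ∫ t : ℝ, ‖LSeries.term a (σ + t * I) n * W t‖
      = ‖LSeries.term a σ n‖ * ∫ t : ℝ, ‖W t‖ := by
    intro n
    rw [← integral_const_mul]
    refine integral_congr_ae (Eventually.of_forall fun t => ?_)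
    simp only [norm_mul, norm_term_vertical]
  have hsum := hasSum_integral_of_summable_integral_norm hFi (by
    simp only [hFn]
    exact ha.norm.mul_right _)
  have hterm : ∀ n : ℕ, a n * g (n / Y)
      = (1 / (2 * π) : ℂ) * ∫ t : ℝ, LSeries.term a (σ + t * I) n * W t := by
    intro n
    rcases eq_or_ne n 0 with rfl | hn
    · simp [hg0]
    have hn0 : (n : ℂ) ≠ 0 := by exact_mod_cast hn
    have hpos : (0 : ℝ) < n / Y := div_pos (by exact_mod_cast Nat.pos_of_ne_zero hn) hY
    rw [← mellinInv_mellin_eq σ g hpos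
      (mellinConvergent_of_hasCompactSupport hg hc (by simpa using hσ)) hv hg.continuousAt,
          mellinInv,
      Complex.real_smul, mul_left_comm, ← integral_const_mul]
    push_cast
    congr 1
    refine integral_congr_ae (Eventually.of_forall fun t => ?_)
    simp only [smul_eq_mul, LSeries.term_of_ne_zero hn, hW]
    have e : ((n : ℂ) / (Y : ℂ)) ^ (-((σ : ℂ) + t * I))
        = (Y : ℂ) ^ ((σ : ℂ) + t * I) / (n : ℂ) ^ ((σ : ℂ) + t * I) := by
      have h1 : (n : ℂ) = ((n : ℝ) : ℂ) := by simp
      rw [h1, Complex.cpow_neg, Complex.div_cpow_ofReal_nonneg (Nat.cast_nonneg n) hY.le, inv_div]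
    rw [e]
    ring
  have hrw : (fun t : ℝ => LSeries a (σ + t * I) * W t)
      = fun t : ℝ => ∑' n, LSeries.term a (σ + t * I) n * W t := by
    ext t
    rw [LSeries, tsum_mul_right]
  refine ⟨?_, ?_⟩
  · refine hWi.bdd_mul (c := ∑' n, ‖LSeries.term a σ n‖) ?_ (Eventually.of_forall fun t => ?_)
    · have : Continuous fun t : ℝ => LSeries a (σ + t * I) :=
        continuous_tsum htc ha.norm fun n t => (norm_term_vertical a σ t n).le
      exact this.aestronglyMeasurable
    · exact tsum_of_norm_bounded ha.norm.hasSum fun n => (norm_term_vertical a σ t n).le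
  · rw [hrw, ← hsum.tsum_eq, ← tsum_mul_left]
    exact tsum_congr hterm

lemma log_add_three_le {q : ℝ} (hq : 1 ≤ q) : Real.log (Real.exp q + 3) ≤ 3 * q := by
  rw [Real.log_le_iff_le_exp (by positivity)]
  have h1 : 2 ≤ Real.exp q := by linarith [Real.add_one_le_exp q]
  have h2 : Real.exp (3 * q) = Real.exp q ^ 3 := by
    rw [← Real.exp_nat_mul]; norm_num
  rw [h2]
  nlinarith [mul_self_nonneg (Real.exp q)]

/-- The smoothed prime number theorem with classical error term for the coefficients
`Λ(n) (1 - χ₄(n)) - 1`. -/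
lemma exists_norm_tsum_inertCoeff_le {g : ℝ → ℂ} (hg : ContDiff ℝ 5 g) (hc : HasCompactSupport g)
    (hg0 : g 0 = 0) : ∃ c > 0, ∃ C, ∀ Y : ℝ, 0 < Y → 1 ≤ Real.log Y →
      ‖∑' n : ℕ, inertCoeff n * g (n / Y)‖ ≤ C * (Y * Real.exp (-c * √(Real.log Y))) := by
  obtain ⟨c, hc0, hc1, C1, hC1, hG⟩ := exists_inertSeries_bound
  obtain ⟨C2, hC2, hM⟩ := exists_mellin_decay 5 (by exact_mod_cast hg) hc 2
  set D := C1 * C2 * 9 with hD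
  have hD0 : 0 ≤ D := by positivity
  refine ⟨min (c / 3) 1, by positivity, π * D + (2 * 2 + π) * (D * Real.exp 1), fun Y hY hL => ?_⟩
  set L := Real.log Y with hLdef
  set q := √L with hq
  have hq1 : 1 ≤ q := by rw [hq]; exact Real.one_le_sqrt.2 hL
  have hq2 : q ^ 2 = L := Real.sq_sqrt (by linarith)
  set T := Real.exp q with hT
  have hT1 : 2 ≤ T := by rw [hT]; linarith [Real.add_one_le_exp q]
  set σ₁ := 1 + 1 / L with hσ₁
  set σ₀ := 1 - c / Real.log (T + 3) with hσ₀
  have hLinv : 1 / L ≤ 1 := by rw [div_le_one (by linarith)]; exact hL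
  have hLinv0 : 0 < 1 / L := by positivity
  have hℓT : 1 ≤ Real.log (T + 3) := by
    have := one_le_log_abs_add_three T
    rwa [abs_of_pos (by linarith)] at this
  have hcT : c / Real.log (T + 3) ≤ c := div_le_self hc0.le hℓT
  have hcT0 : 0 < c / Real.log (T + 3) := by positivity
  have hYexp : Y = Real.exp L := (Real.exp_log hY).symm
  have hY1 : 1 ≤ Y := by rw [hYexp]; exact Real.one_le_exp (by linarith)
  have hYσ₁ : Y ^ σ₁ = Real.exp 1 * Y := by
    rw [hσ₁, Real.rpow_add hY, Real.rpow_one, mul_comm, Real.rpow_def_of_pos hY, ← hLdef,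
      mul_one_div_cancel (by linarith)]
  have hYσ₀ : Y ^ σ₀ ≤ Y * Real.exp (-min (c / 3) 1 * q) := by
    rw [hσ₀, Real.rpow_sub hY, Real.rpow_one, div_eq_mul_inv, Real.rpow_def_of_pos hY, ← hLdef,
      ← Real.exp_neg]
    gcongr
    rw [neg_mul, neg_le_neg_iff]
    calc min (c / 3) 1 * q ≤ c / 3 * q := by gcongr; exact min_le_left _ _
      _ = L * (c / (3 * q)) := by rw [← hq2]; field_simp
      _ ≤ L * (c / Real.log (T + 3)) := by
        gcongr
        exact log_add_three_le hq1
  have hTexp : T⁻¹ ≤ Real.exp (-min (c / 3) 1 * q) := by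
    rw [hT, ← Real.exp_neg]
    gcongr
    have : min (c / 3) 1 * q ≤ 1 * q := by gcongr; exact min_le_right _ _
    linarith
  set P : ℂ → ℂ := fun s => inertSeries s * (mellin g s * (Y : ℂ) ^ s) with hP
  have hmel : ∀ s : ℂ, 1 / 2 ≤ s.re → s.re ≤ 2 →
      ‖mellin g s‖ ≤ C2 / (|s.im| + 1) ^ 5 := fun s h1 h2 => by exact_mod_cast hM s h1 h2
  have hPb : ∀ s : ℂ, 1 - c / Real.log (|s.im| + 3) ≤ s.re → s.re ≤ 2 →
      ‖P s‖ ≤ D * Y ^ s.re * ((1 + s.im ^ 2)⁻¹ * (|s.im| + 1)⁻¹) := by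
    intro s h1 h2
    have hℓ := one_le_log_abs_add_three s.im
    have hcℓ : c / Real.log (|s.im| + 3) ≤ c := div_le_self hc0.le hℓ
    have hbG := (hG s h1 h2).2
    have hbM := hmel s (by linarith) h2
    have habs := abs_nonneg s.im
    rw [hP, norm_mul, norm_mul, Complex.norm_cpow_eq_rpow_re_of_pos hY]
    calc ‖inertSeries s‖ * (‖mellin g s‖ * Y ^ s.re)
        ≤ C1 * (|s.im| + 3) ^ 2 * (C2 / (|s.im| + 1) ^ 5 * Y ^ s.re) := by gcongr
      _ ≤ C1 * (3 * (|s.im| + 1)) ^ 2 * (C2 / (|s.im| + 1) ^ 5 * Y ^ s.re) := by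
        gcongr; linarith
      _ = D * Y ^ s.re * (((|s.im| + 1) ^ 2)⁻¹ * (|s.im| + 1)⁻¹) := by
        rw [hD]; field_simp; ring
      _ ≤ _ := by
        gcongr
        rw [← sq_abs s.im]; nlinarith
  have hre1 : ∀ t : ℝ, ((σ₁ : ℂ) + t * I).re = σ₁ := fun t => by simp
  have him1 : ∀ t : ℝ, ((σ₁ : ℂ) + t * I).im = t := fun t => by simp
  have hre0 : ∀ t : ℝ, ((σ₀ : ℂ) + t * I).re = σ₀ := fun t => by simp
  have him0 : ∀ t : ℝ, ((σ₀ : ℂ) + t * I).im = t := fun t => by simp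
  have hpos : ∀ t : ℝ, 0 < c / Real.log (|t| + 3) := fun t => by
    have := one_le_log_abs_add_three t
    positivity
  have hregion : ∀ s : ℂ, σ₀ ≤ s.re → |s.im| ≤ T → 1 - c / Real.log (|s.im| + 3) ≤ s.re := by
    intro s h1 h2
    have hℓ := one_le_log_abs_add_three s.im
    have : c / Real.log (T + 3) ≤ c / Real.log (|s.im| + 3) := by gcongr
    linarith
  have hv : Integrable fun t : ℝ => mellin g (σ₁ + t * I) := by
    refine (integrable_inv_one_add_sq.const_mul C2).mono' ?_ (Eventually.of_forall fun t => ?_)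
    · refine Continuous.aestronglyMeasurable ?_
      refine continuous_iff_continuousAt.2 fun t => ?_
      have h1 : ContinuousAt (mellin g) (σ₁ + t * I) :=
        (differentiableAt_mellin_of_hasCompactSupport hg.continuous hc
          (by rw [hre1]; linarith)).continuousAt
      exact ContinuousAt.comp (f := fun t : ℝ => (σ₁ : ℂ) + t * I) h1 (by fun_prop)
    · refine (hmel _ (by rw [hre1]; linarith) (by rw [hre1]; linarith)).trans ?_
      rw [him1, div_eq_mul_inv]
      gcongr
      have habs := abs_nonneg t
      have h1 : 1 + t ^ 2 ≤ (|t| + 1) ^ 2 := by rw [← sq_abs t]; nlinarith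
      exact h1.trans (pow_le_pow_right₀ (by linarith) (by norm_num))
  obtain ⟨hint, heq⟩ := tsum_mul_eq_integral (a := inertCoeff) (σ := σ₁) (by linarith) hY
    (LSeriesSummable_inertCoeff (by rw [Complex.ofReal_re]; linarith)) hg.continuous hc hg0 hv
  have hPL : (fun t : ℝ => LSeries inertCoeff (σ₁ + t * I) *
      (mellin g (σ₁ + t * I) * (Y : ℂ) ^ ((σ₁ : ℂ) + t * I))) = fun t : ℝ => P (σ₁ + t * I) := by
    ext t
    rw [hP, ← inertSeries_eq_LSeries (by rw [hre1]; linarith)]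
  rw [hPL] at hint heq
  set B := D * (Real.exp 1 * Y) * T⁻¹ with hB
  have hB0 : 0 ≤ B := by positivity
  have hmain := norm_integral_vertical_le (H := P) (σ₀ := σ₀) (σ₁ := σ₁) (T := T) (A := D * Y ^ σ₀)
    (B := B) (by linarith) (by linarith) (by positivity) hB0 ?_ ?_ ?_ ?_ hint
  · rw [heq, norm_mul]
    have hpi : ‖(1 / (2 * π) : ℂ)‖ ≤ 1 := by
      have : (1 / (2 * π) : ℂ) = ((1 / (2 * π) : ℝ) : ℂ) := by push_cast; rfl
      rw [this, Complex.norm_real, Real.norm_eq_abs, abs_of_pos (by positivity),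
        div_le_one (by positivity)]
      linarith [Real.pi_gt_three]
    have hpi0 := Real.pi_pos
    calc ‖(1 / (2 * π) : ℂ)‖ * ‖∫ t : ℝ, P (σ₁ + t * I)‖
        ≤ 1 * (π * (D * Y ^ σ₀) + (2 * (σ₁ - σ₀) + π) * B) := by gcongr
      _ ≤ π * (D * (Y * Real.exp (-min (c / 3) 1 * q))) +
          (2 * 2 + π) * (D * (Real.exp 1 * Y) * Real.exp (-min (c / 3) 1 * q)) := by
        rw [one_mul, hB]
        gcongr
        linarith
      _ = _ := by ring
  · intro s h1 h2 h3
    have hs : 0 < s.re := by linarith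
    refine (hG s (hregion s h1 h3) (by linarith)).1.mul
      ((differentiableAt_mellin_of_hasCompactSupport hg.continuous hc hs).mul ?_)
    exact differentiableAt_id.const_cpow (.inl (by exact_mod_cast hY.ne'))
  · intro t ht
    refine (hPb _ (hregion _ (by rw [hre0]) (by rwa [him0])) (by rw [hre0]; linarith)).trans ?_
    rw [hre0, him0]
    have habs := abs_nonneg t
    have : (|t| + 1)⁻¹ ≤ 1 := inv_le_one_of_one_le₀ (by linarith)
    calc D * Y ^ σ₀ * ((1 + t ^ 2)⁻¹ * (|t| + 1)⁻¹)
        ≤ D * Y ^ σ₀ * ((1 + t ^ 2)⁻¹ * 1) := by gcongr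
      _ = _ := by rw [mul_one]
  · intro s h1 h2 h3
    refine (hPb s (hregion s h1 h3.le) (by linarith)).trans ?_
    have e1 : Y ^ s.re ≤ Real.exp 1 * Y := by
      rw [← hYσ₁]; exact Real.rpow_le_rpow_of_exponent_le hY1 h2
    have e2 : (1 + s.im ^ 2)⁻¹ ≤ 1 := inv_le_one_of_one_le₀ (by nlinarith)
    have e3 : (|s.im| + 1)⁻¹ ≤ T⁻¹ := by rw [h3]; gcongr; linarith
    calc D * Y ^ s.re * ((1 + s.im ^ 2)⁻¹ * (|s.im| + 1)⁻¹)
        ≤ D * (Real.exp 1 * Y) * (1 * T⁻¹) := by gcongr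
      _ = B := by rw [hB, one_mul]
  · intro t ht
    refine (hPb _ (by rw [hre1, him1]; linarith [hpos t]) (by rw [hre1]; linarith)).trans ?_
    rw [hre1, him1, hYσ₁]
    have e3 : (|t| + 1)⁻¹ ≤ T⁻¹ := by gcongr; linarith
    calc D * (Real.exp 1 * Y) * ((1 + t ^ 2)⁻¹ * (|t| + 1)⁻¹)
        ≤ D * (Real.exp 1 * Y) * ((1 + t ^ 2)⁻¹ * T⁻¹) := by gcongr
      _ = _ := by rw [hB]; ring

lemma idealNorm_span_natCast (n : ℕ) : idealNorm (Ideal.span {(n : GaussianInt)}) = n ^ 2 := by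
  let f : GaussianInt →+ ZMod n × ZMod n :=
    { toFun := fun z => (z.re, z.im)
      map_zero' := by simp
      map_add' := fun x y => by simp }
  have hf : Function.Surjective f := fun ⟨a, b⟩ => by
    obtain ⟨a, rfl⟩ := ZMod.intCast_surjective a
    obtain ⟨b, rfl⟩ := ZMod.intCast_surjective b
    exact ⟨⟨a, b⟩, rfl⟩
  have hker : f.ker = (Ideal.span {(n : GaussianInt)}).toAddSubgroup := by
    ext z
    change f z = 0 ↔ z ∈ Ideal.span {(n : GaussianInt)}
    rw [Ideal.mem_span_singleton]
    have := Zsqrtd.intCast_dvd (n : ℤ) z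
    rw [Int.cast_natCast] at this
    rw [this, ← ZMod.intCast_zmod_eq_zero_iff_dvd, ← ZMod.intCast_zmod_eq_zero_iff_dvd]
    exact Prod.ext_iff
  have h : idealNorm (Ideal.span {(n : GaussianInt)}) = Nat.card (GaussianInt ⧸ f.ker) := by
    rw [hker]; rfl
  rw [h, Nat.card_congr (QuotientAddGroup.quotientKerEquivOfSurjective f hf).toEquiv,
    Nat.card_prod, Nat.card_zmod, sq]

lemma eq_natCast_of_arg_eq_zero {z : GaussianInt} (hz : (GaussianInt.toComplex z).arg = 0) :
    ∃ n : ℕ, z = n := by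
  rw [Complex.arg_eq_zero_iff] at hz
  obtain ⟨h1, h2⟩ := hz
  rw [← GaussianInt.intCast_re] at h1
  rw [← GaussianInt.intCast_im] at h2
  obtain ⟨n, hn⟩ := Int.eq_ofNat_of_zero_le (by exact_mod_cast h1 : (0 : ℤ) ≤ z.re)
  have h3 : z.im = 0 := by exact_mod_cast h2
  exact ⟨n, Zsqrtd.ext (by simpa using hn) (by simpa using h3)⟩

/-- Every Gaussian integer has an associate in the sector `0 ≤ arg < π / 2`. -/
lemma exists_associated_arg_mem (z : GaussianInt) :
    ∃ w, Associated z w ∧ (GaussianInt.toComplex w).arg ∈ Set.Ico 0 (π / 2) := by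
  have key : ∀ w : GaussianInt, (w = 0 ∨ 0 < w.re ∧ 0 ≤ w.im) →
      (GaussianInt.toComplex w).arg ∈ Set.Ico 0 (π / 2) := by
    rintro w (rfl | ⟨h1, h2⟩)
    · simp [Real.pi_pos]
    · have h1 : 0 < (GaussianInt.toComplex w).re := by
        rw [← GaussianInt.intCast_re]; exact_mod_cast h1
      have h2 : 0 ≤ (GaussianInt.toComplex w).im := by
        rw [← GaussianInt.intCast_im]; exact_mod_cast h2
      exact ⟨Complex.arg_nonneg_iff.2 h2,
        (abs_lt.1 (Complex.abs_arg_lt_pi_div_two_iff.2 (.inl h1))).2⟩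
  have hi : IsUnit (⟨0, 1⟩ : GaussianInt) :=
    isUnit_iff_exists_inv.2 ⟨⟨0, -1⟩, by ext <;> simp⟩
  have hrot : ∀ w : GaussianInt, Associated w (w * ⟨0, 1⟩) := fun w =>
    (associated_mul_unit_right w _ hi)
  have hre : ∀ w : GaussianInt, (w * ⟨0, 1⟩).re = -w.im := fun w => by simp
  have him : ∀ w : GaussianInt, (w * ⟨0, 1⟩).im = w.re := fun w => by simp
  by_cases h0 : z = 0
  · exact ⟨z, .refl z, key z (.inl h0)⟩
  have hz : z.re ≠ 0 ∨ z.im ≠ 0 := by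
    by_contra! h
    exact h0 (Zsqrtd.ext h.1 h.2)
  rcases lt_trichotomy z.re 0 with h1 | h1 | h1 <;> rcases lt_trichotomy z.im 0 with h2 | h2 | h2
  case neg.inl.inl | neg.inl.inr.inl =>
    refine ⟨_, (hrot z).trans (hrot _), key _ (.inr ?_)⟩
    simp only [hre, him]; omega
  case neg.inl.inr.inr | neg.inr.inl.inr.inr =>
    refine ⟨_, ((hrot z).trans (hrot _)).trans (hrot _), key _ (.inr ?_)⟩
    simp only [hre, him]; omega
  case neg.inr.inl.inl | neg.inr.inr.inl =>
    refine ⟨_, hrot z, key _ (.inr ?_)⟩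
    simp only [hre, him]; omega
  case neg.inr.inl.inr.inl => omega
  all_goals exact ⟨z, .refl z, key z (.inr (by omega))⟩

lemma idealTheta_span_natCast (n : ℕ) : idealTheta (Ideal.span {(n : GaussianInt)}) = 0 := by
  unfold idealTheta
  split_ifs with h
  swap
  · rfl
  obtain ⟨h1, h2, h3⟩ := h.choose_spec
  set α := h.choose
  obtain ⟨u, hu⟩ := Ideal.span_singleton_eq_span_singleton.1 h1.symm
  rcases Nat.eq_zero_or_pos n with rfl | hn
  · simp [← hu]
  have hn' : 0 < (n : ℤ) := by exact_mod_cast hn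
  have hα : GaussianInt.toComplex α ≠ 0 := by
    rw [Ne, GaussianInt.toComplex_eq_zero, ← hu]
    simpa using hn.ne'
  have hre : 0 < α.re := by
    have := (Complex.abs_arg_lt_pi_div_two_iff.1
      (abs_lt.2 ⟨by linarith [Real.pi_pos], h3⟩)).resolve_right hα
    rw [← GaussianInt.intCast_re] at this
    exact_mod_cast this
  have him : 0 ≤ α.im := by
    have := Complex.arg_nonneg_iff.1 h2
    rw [← GaussianInt.intCast_im] at this
    exact_mod_cast this
  have hu1 : (u : GaussianInt).re * u.1.re + u.1.im * u.1.im = 1 := by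
    have := (Zsqrtd.norm_eq_one_iff' (by norm_num) u.1).2 u.isUnit
    rw [Zsqrtd.norm_def] at this
    linarith
  have e1 : α.re = n * u.1.re := by simp [← hu]
  have e2 : α.im = n * u.1.im := by simp [← hu]
  have f1 : 0 < u.1.re := pos_of_mul_pos_right (e1 ▸ hre) hn'.le
  have f2 : u.1.im = 0 := by nlinarith
  have : GaussianInt.toComplex α = ((α.re : ℝ) : ℂ) := by
    rw [GaussianInt.toComplex_def, e2, f2]; push_cast; ring
  rw [this, Complex.arg_ofReal_of_nonneg (by exact_mod_cast hre.le)]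

lemma exists_natCast_of_idealTheta_eq_zero {J : Ideal GaussianInt} (hJ : idealTheta J = 0) :
    ∃ n : ℕ, J = Ideal.span {(n : GaussianInt)} := by
  have h : ∃ α : GaussianInt, Ideal.span {α} = J ∧
      (GaussianInt.toComplex α).arg ∈ Set.Ico 0 (π / 2) := by
    obtain ⟨z, rfl⟩ := (IsPrincipalIdealRing.principal J).principal
    obtain ⟨w, hw, hw'⟩ := exists_associated_arg_mem z
    exact ⟨w, Ideal.span_singleton_eq_span_singleton.2 hw.symm, hw'⟩
  rw [idealTheta, dif_pos h] at hJ
  obtain ⟨n, hn⟩ := eq_natCast_of_arg_eq_zero hJ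
  exact ⟨n, by rw [← h.choose_spec.1, hn]⟩

/-- The sum over ideals with vanishing angle, as a sum over their natural number generators. -/
lemma inertSum_eq_tsum {Φ : ℝ → ℝ} (hΦ : Φ 0 = 0) (X : ℝ) :
    inertSum Φ X =
      ∑' n : ℕ, idealLambda (Ideal.span {(n : GaussianInt)}) * Φ ((n : ℝ) ^ 2 / X) := by
  have hspan : ∀ n : ℕ, n ≠ 0 → Ideal.span {(n : GaussianInt)} ≠ ⊥ ∧
      idealTheta (Ideal.span {(n : GaussianInt)}) = 0 := fun n hn =>
    ⟨by simpa using hn, idealTheta_span_natCast n⟩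
  let e : ({n : ℕ | n ≠ 0} : Set ℕ) → {J : Ideal GaussianInt // J ≠ ⊥ ∧ idealTheta J = 0} :=
    fun n => ⟨Ideal.span {(n.1 : GaussianInt)}, hspan n.1 n.2⟩
  have he : Function.Bijective e := by
    constructor
    · rintro ⟨m, hm⟩ ⟨n, hn⟩ h
      have h1 := congrArg (fun J => idealNorm J.1) h
      simp only [e, idealNorm_span_natCast] at h1
      exact Subtype.ext (Nat.pow_left_injective two_ne_zero h1)
    · rintro ⟨J, hJ, hJ0⟩
      obtain ⟨n, rfl⟩ := exists_natCast_of_idealTheta_eq_zero hJ0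
      exact ⟨⟨n, by rintro rfl; simp at hJ⟩, rfl⟩
  rw [inertSum, ← (Equiv.ofBijective e he).tsum_eq]
  simp only [Equiv.ofBijective_apply, e, idealNorm_span_natCast, Nat.cast_pow]
  refine tsum_subtype_eq_of_support_subset (s := {n : ℕ | n ≠ 0})
    (f := fun n : ℕ => idealLambda (Ideal.span {(n : GaussianInt)}) * Φ ((n : ℝ) ^ 2 / X)) ?_
  rintro n hn rfl
  simp [hΦ] at hn

lemma Prime.dvd_of_dvd_pow_of_not_isUnit {R : Type*} [CommRing R] [IsDomain R] {p a : R}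
    (hp : Prime p) {r : ℕ} (ha : ¬ IsUnit a) (h : a ∣ p ^ r) : p ∣ a := by
  obtain ⟨j, -, hj⟩ := (dvd_prime_pow hp r).1 h
  rcases Nat.eq_zero_or_pos j with rfl | hj0
  · exact absurd (associated_one_iff_isUnit.1 (by simpa using hj)) ha
  · exact (dvd_pow_self p hj0.ne').trans hj.symm.dvd

/-- The von Mangoldt function at the ideal generated by a natural number. -/
def natLambda (n : ℕ) : ℝ := idealLambda (Ideal.span {(n : GaussianInt)})

/-- Either the value of `natLambda` vanishes, or it comes from a Gaussian prime. -/
lemma natLambda_cases (n : ℕ) : natLambda n = 0 ∨ ∃ ϖ : GaussianInt, ∃ r : ℕ, Prime ϖ ∧ 0 < r ∧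
    Associated (n : GaussianInt) (ϖ ^ r) ∧
    natLambda n = Real.log (idealNorm (Ideal.span {ϖ})) := by
  unfold natLambda idealLambda
  split_ifs with h
  swap
  · exact .inl rfl
  right
  obtain ⟨r, hP, hP0, hr, hn⟩ := h.choose_spec
  set P := h.choose
  obtain ⟨ϖ, hϖ⟩ := (IsPrincipalIdealRing.principal P).principal
  rw [Ideal.submodule_span_eq] at hϖ
  have hϖ0 : ϖ ≠ 0 := by rintro rfl; simp [hϖ] at hP0
  refine ⟨ϖ, r, ?_, hr, ?_, by rw [hϖ]⟩
  · rw [hϖ] at hP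
    exact (Ideal.span_singleton_prime hϖ0).1 hP
  · rw [hϖ, Ideal.span_singleton_pow] at hn
    exact Ideal.span_singleton_eq_span_singleton.1 hn

lemma natLambda_nonneg (n : ℕ) : 0 ≤ natLambda n := by
  rcases natLambda_cases n with h | ⟨ϖ, r, -, -, -, h⟩
  · exact h.ge
  · rw [h]; exact Real.log_natCast_nonneg _

lemma natLambda_le (n : ℕ) : natLambda n ≤ 2 * Real.log n := by
  rcases natLambda_cases n with h | ⟨ϖ, r, hϖ, hr, hn, h⟩
  · rw [h]; positivity
  · have hn0 : n ≠ 0 := by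
      rintro rfl
      exact pow_ne_zero r hϖ.ne_zero ((associated_zero_iff_eq_zero _).1 (by simpa using hn.symm))
    have hle : Ideal.span {(n : GaussianInt)} ≤ Ideal.span {ϖ} :=
      Ideal.span_singleton_le_span_singleton.2 ((dvd_pow_self ϖ hr.ne').trans hn.symm.dvd)
    have hcard : idealNorm (Ideal.span {(n : GaussianInt)}) = n ^ 2 := idealNorm_span_natCast n
    have : Finite (GaussianInt ⧸ Ideal.span {(n : GaussianInt)}) :=
      Nat.finite_of_card_ne_zero (hcard.trans_ne (by positivity))
    have hsurj : Function.Surjective (Ideal.Quotient.factor hle) :=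
      Ideal.Quotient.factor_surjective hle
    have : Finite (GaussianInt ⧸ Ideal.span {ϖ}) := Finite.of_surjective _ hsurj
    have h1 : idealNorm (Ideal.span {ϖ}) ≤ n ^ 2 := hcard ▸ Nat.card_le_card_of_surjective _ hsurj
    have h2 : 0 < idealNorm (Ideal.span {ϖ}) := Nat.card_pos
    rw [h]
    calc Real.log (idealNorm (Ideal.span {ϖ})) ≤ Real.log ((n : ℝ) ^ 2) := by
          gcongr; exact_mod_cast h1
      _ = _ := by rw [Real.log_pow]; norm_num

lemma natLambda_prime_pow_of_mod_four_eq_three {p k : ℕ} (hp : p.Prime) (hp3 : p % 4 = 3)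
    (hk : 0 < k) : natLambda (p ^ k) = 2 * Real.log p := by
  have : Fact p.Prime := ⟨hp⟩
  have hpp : Prime (p : GaussianInt) := GaussianInt.prime_of_nat_prime_of_mod_four_eq_three p hp3
  have h : ∃ P : Ideal GaussianInt, ∃ r : ℕ, P.IsPrime ∧ P ≠ ⊥ ∧ 0 < r ∧
      Ideal.span {((p ^ k : ℕ) : GaussianInt)} = P ^ r :=
    ⟨Ideal.span {(p : GaussianInt)}, k, (Ideal.span_singleton_prime hpp.ne_zero).2 hpp,
      by simpa using hp.ne_zero, hk, by rw [Ideal.span_singleton_pow, Nat.cast_pow]⟩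
  rw [natLambda, idealLambda, dif_pos h]
  obtain ⟨r, hP, hP0, hr, hn⟩ := h.choose_spec
  set P := h.choose
  have hmem : (p : GaussianInt) ∈ P := by
    refine hP.mem_of_pow_mem k ?_
    have : ((p ^ k : ℕ) : GaussianInt) ∈ P ^ r := hn ▸ Ideal.mem_span_singleton_self _
    rw [← Nat.cast_pow]
    exact Ideal.pow_le_self hr.ne' this
  have hmax : (Ideal.span {(p : GaussianInt)}).IsMaximal :=
    PrincipalIdealRing.isMaximal_of_irreducible hpp.irreducible
  rw [← hmax.eq_of_le hP.ne_top ((Ideal.span_singleton_le_iff_mem _).2 hmem),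
    idealNorm_span_natCast, Nat.cast_pow, Real.log_pow]
  norm_num

lemma natLambda_eq_zero_of_dvd {n p q : ℕ} (hp : p.Prime) (hq : q.Prime) (hpq : p ≠ q)
    (hpn : p ∣ n) (hqn : q ∣ n) : natLambda n = 0 := by
  rcases natLambda_cases n with h | ⟨ϖ, r, hϖ, hr, hn, -⟩
  · exact h
  have key : ∀ l : ℕ, l.Prime → l ∣ n → ϖ ∣ (l : GaussianInt) := fun l hl hln =>
    hϖ.dvd_of_dvd_pow_of_not_isUnit
      (by rw [← Zsqrtd.norm_eq_one_iff]; simp [Int.natAbs_mul, hl.ne_one])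
      ((Nat.cast_dvd_cast hln).trans hn.dvd)
  have hco : IsCoprime (p : GaussianInt) (q : GaussianInt) := by
    have := (Nat.isCoprime_iff_coprime.2 ((Nat.coprime_primes hp hq).2 hpq)).map
      (Int.castRingHom GaussianInt)
    simpa using this
  exact absurd (hco.isUnit_of_dvd' (key p hp hpn) (key q hq hqn)) hϖ.not_isUnit

lemma natLambda_prime_pow_of_mod_four_eq_one {p k : ℕ} (hp : p.Prime) (hp1 : p % 4 = 1) :
    natLambda (p ^ k) = 0 := by
  rcases natLambda_cases (p ^ k) with h | ⟨ϖ, r, hϖ, hr, hn, -⟩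
  · exact h
  exfalso
  have : Fact p.Prime := ⟨hp⟩
  obtain ⟨a, b, hab⟩ := Nat.Prime.sq_add_sq (p := p) (by omega)
  have hk : k ≠ 0 := by
    rintro rfl
    rw [pow_zero, Nat.cast_one] at hn
    exact hϖ.not_isUnit (isUnit_of_dvd_one ((dvd_pow_self ϖ hr.ne').trans hn.symm.dvd))
  have key : ∀ w : GaussianInt, w.norm = p → w ∣ p → ϖ ∣ w := fun w hw hwp =>
    hϖ.dvd_of_dvd_pow_of_not_isUnit
      (by rw [← Zsqrtd.norm_eq_one_iff, hw, Int.natAbs_natCast]; exact hp.ne_one)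
      (hwp.trans (((dvd_pow_self (p : GaussianInt) hk).trans (by rw [Nat.cast_pow])).trans hn.dvd))
  have hprod : (⟨a, b⟩ * ⟨a, -b⟩ : GaussianInt) = p := by
    rw [← hab]; ext <;> simp [-Nat.cast_add, -Nat.cast_pow] <;> ring
  have h1 : ϖ ∣ ⟨a, b⟩ :=
    key _ (by rw [Zsqrtd.norm_def, ← hab]; push_cast; ring) (hprod ▸ dvd_mul_right _ _)
  have h2 : ϖ ∣ ⟨a, -b⟩ :=
    key _ (by rw [Zsqrtd.norm_def, ← hab]; push_cast; ring) (hprod ▸ dvd_mul_left _ _)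
  have hdvd : ∀ w : GaussianInt, ϖ ∣ w → ϖ.norm.natAbs ∣ w.norm.natAbs := by
    rintro _ ⟨w, rfl⟩
    rw [Zsqrtd.norm_mul, Int.natAbs_mul]
    exact dvd_mul_right _ _
  have h3 : ϖ.norm.natAbs = p := by
    refine ((Nat.dvd_prime hp).1 ?_).resolve_left (mt Zsqrtd.norm_eq_one_iff.1 hϖ.not_isUnit)
    convert hdvd _ h1
    rw [Zsqrtd.norm_def, ← Int.natAbs_natCast p, ← hab]
    push_cast; ring_nf
  have h4 : p ∣ 2 ^ 2 * a ^ 2 := by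
    have := hdvd _ (dvd_add h1 h2)
    rw [h3] at this
    convert this
    rw [Zsqrtd.norm_def, ← Int.natAbs_natCast (2 ^ 2 * a ^ 2)]
    congr 1
    simp
    ring
  have h5 : p ∣ a := by
    rcases hp.dvd_mul.1 h4 with h | h
    · have := Nat.le_of_dvd two_pos (hp.dvd_of_dvd_pow h)
      have := hp.two_le
      omega
    · exact hp.dvd_of_dvd_pow h
  rcases Nat.eq_zero_or_pos a with rfl | ha
  · exact hp.not_isSquare ⟨b, by rw [← hab]; ring⟩
  · have := Nat.le_of_dvd ha h5
    nlinarith [hp.two_le]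

/-- Away from squares and doubled squares, `natLambda` is a combination of the von Mangoldt
function and its twist by the nontrivial character modulo four. -/
lemma natLambda_eq_vonMangoldt {n : ℕ} (h1 : ∀ m, n ≠ m ^ 2) (h2 : ∀ m, n ≠ 2 * m ^ 2) :
    natLambda n = ArithmeticFunction.vonMangoldt n * (1 - (ZMod.χ₄ n : ℤ)) := by
  by_cases hn : IsPrimePow n
  · obtain ⟨p, k, hp, hk, rfl⟩ := hn
    rw [← Nat.prime_iff] at hp
    have hk2 : k % 2 = 1 := by
      by_contra h
      exact h1 (p ^ (k / 2)) (by rw [← pow_mul]; congr 1; omega)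
    rw [ArithmeticFunction.vonMangoldt_apply_pow hk.ne',
      ArithmeticFunction.vonMangoldt_apply_prime hp, Nat.cast_pow, map_pow]
    have hp2 : p ≠ 2 := by
      rintro rfl
      refine h2 (2 ^ (k / 2)) ?_
      rw [← pow_mul, ← pow_succ']
      congr 1; omega
    have hodd := hp.eq_two_or_odd.resolve_left hp2
    rcases (by omega : p % 4 = 1 ∨ p % 4 = 3) with h | h
    · rw [natLambda_prime_pow_of_mod_four_eq_one hp h, ZMod.χ₄_nat_one_mod_four h]
      simp
    · rw [natLambda_prime_pow_of_mod_four_eq_three hp h hk, ZMod.χ₄_nat_three_mod_four h,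
        (Nat.odd_iff.2 hk2).neg_one_pow]
      push_cast; ring
  · rw [ArithmeticFunction.vonMangoldt_eq_zero_iff.2 hn, zero_mul]
    have hn1 : n ≠ 1 := fun h => h1 1 (by simpa using h)
    obtain ⟨p, hp, hpn⟩ := Nat.exists_prime_and_dvd hn1
    obtain ⟨q, ⟨hq, hqn⟩, hqp⟩ : ∃ q, (q.Prime ∧ q ∣ n) ∧ q ≠ p := by
      by_contra! h
      exact hn (isPrimePow_iff_unique_prime_dvd.2 ⟨p, ⟨hp, hpn⟩, h⟩)
    exact natLambda_eq_zero_of_dvd hp hq hqp.symm hpn hqn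

lemma abs_natLambda_sub_le (n : ℕ) :
    |natLambda n - ArithmeticFunction.vonMangoldt n * (1 - (ZMod.χ₄ n : ℤ))| ≤ 2 * Real.log n := by
  have hΛ0 : 0 ≤ ArithmeticFunction.vonMangoldt n := ArithmeticFunction.vonMangoldt_nonneg
  have hΛ : ArithmeticFunction.vonMangoldt n ≤ Real.log n := ArithmeticFunction.vonMangoldt_le_log
  have hχ : ((ZMod.χ₄ n : ℤ) : ℝ) ≤ 1 ∧ -1 ≤ ((ZMod.χ₄ n : ℤ) : ℝ) := by
    have : ∀ a : ZMod 4, ZMod.χ₄ a ≤ 1 ∧ -1 ≤ ZMod.χ₄ a := by decide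
    exact_mod_cast this n
  rw [abs_le]
  constructor <;> nlinarith [natLambda_nonneg n, natLambda_le n]

/-- The weighted difference of `natLambda` and `Λ(n) (1 - χ₄(n))` is supported on squares and
doubled squares. -/
lemma sum_abs_natLambda_sub_le {N : ℕ} :
    ∑ n ∈ Finset.range (N + 1),
      |natLambda n - ArithmeticFunction.vonMangoldt n * (1 - (ZMod.χ₄ n : ℤ))|
        ≤ 4 * (√N + 1) * Real.log N := by
  set s := (Finset.range (Nat.sqrt N + 1)).image (fun m => m ^ 2) ∪
    (Finset.range (Nat.sqrt N + 1)).image (fun m => 2 * m ^ 2) with hs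
  have hcard : (s.card : ℝ) ≤ 2 * (√N + 1) := by
    have h1 : s.card ≤ (Nat.sqrt N + 1) + (Nat.sqrt N + 1) := by
      refine (Finset.card_union_le _ _).trans ?_
      gcongr <;> exact Finset.card_image_le.trans (by simp)
    have h2 : (s.card : ℝ) ≤ (Nat.sqrt N + 1) + (Nat.sqrt N + 1) := by exact_mod_cast h1
    have := Real.nat_sqrt_le_real_sqrt (a := N)
    linarith
  have hzero : ∀ n ∈ Finset.range (N + 1), n ∉ s ∩ Finset.range (N + 1) →
      |natLambda n - ArithmeticFunction.vonMangoldt n * (1 - (ZMod.χ₄ n : ℤ))| = 0 := by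
    intro n hn hns
    have hns : n ∉ s := fun h => hns (Finset.mem_inter.2 ⟨h, hn⟩)
    have hnN : n ≤ N := by simpa [Nat.lt_succ_iff] using hn
    simp only [hs, Finset.mem_union, Finset.mem_image, Finset.mem_range, not_or, not_exists,
      not_and] at hns
    rw [natLambda_eq_vonMangoldt, sub_self, abs_zero]
    · rintro m rfl
      exact hns.1 m (Nat.lt_succ_of_le (Nat.le_sqrt'.2 hnN)) rfl
    · rintro m rfl
      exact hns.2 m (Nat.lt_succ_of_le (Nat.le_sqrt'.2 (by omega))) rfl
  rw [← Finset.sum_subset Finset.inter_subset_right hzero]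
  calc _ ≤ ∑ n ∈ s ∩ Finset.range (N + 1), 2 * Real.log N := by
        refine Finset.sum_le_sum fun n hn => (abs_natLambda_sub_le n).trans ?_
        have hnN : n ≤ N := by simpa [Nat.lt_succ_iff] using (Finset.mem_inter.1 hn).2
        rcases Nat.eq_zero_or_pos n with rfl | h0
        · simpa using Real.log_natCast_nonneg N
        · gcongr
    _ ≤ s.card * (2 * Real.log N) := by
        rw [Finset.sum_const, nsmul_eq_mul]
        have := Real.log_natCast_nonneg N
        gcongr
        exact Finset.inter_subset_left
    _ ≤ 2 * (√N + 1) * (2 * Real.log N) := by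
        have := Real.log_natCast_nonneg N
        gcongr
    _ = _ := by ring

lemma exists_eq_zero_of_hasCompactSupport {E : Type*} [Zero E] {f : ℝ → E}
    (hc : HasCompactSupport f) : ∃ R : ℝ, 0 ≤ R ∧ ∀ x, R ≤ x → f x = 0 := by
  obtain ⟨R, hR⟩ := hc.isCompact.isBounded.subset_closedBall 0
  refine ⟨max R 0 + 1, by positivity, fun x hx => ?_⟩
  by_contra h
  have h1 := hR (subset_tsupport f h)
  rw [mem_closedBall_zero_iff, Real.norm_eq_abs] at h1
  linarith [le_abs_self x, le_max_left R 0]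

/-- A smooth compactly supported function has bounded Riemann sum error. -/
lemma exists_abs_tsum_sub_integral_le {f : ℝ → ℝ} (hf : ContDiff ℝ 1 f) (hc : HasCompactSupport f) :
    ∃ C, ∀ Y : ℝ, 1 ≤ Y → |∑' n : ℕ, f (n / Y) - Y * ∫ x in Set.Ioi 0, f x| ≤ C := by
  obtain ⟨K, hK⟩ := hf.lipschitzWith_of_hasCompactSupport hc (by norm_num)
  obtain ⟨R, hR0, hR⟩ := exists_eq_zero_of_hasCompactSupport hc
  refine ⟨(R + 1) * K, fun Y hY => ?_⟩
  have hY0 : 0 < Y := by linarith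
  set N := ⌈R * Y⌉₊ with hN
  have hN1 : R ≤ N / Y := by rw [le_div_iff₀ hY0]; exact Nat.le_ceil _
  have hN2 : (N : ℝ) ≤ R * Y + 1 := (Nat.ceil_lt_add_one (by positivity)).le
  have hcont : Continuous fun u : ℝ => f (u / Y) := hf.continuous.comp (by fun_prop)
  have hsum : ∑' n : ℕ, f (n / Y) = ∑ n ∈ Finset.range N, f (n / Y) := by
    refine tsum_eq_sum fun n hn => hR _ (hN1.trans ?_)
    rw [Finset.mem_range, not_lt] at hn
    gcongr
  have hint : Y * ∫ x in Set.Ioi 0, f x =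
      ∑ n ∈ Finset.range N, ∫ u in (n : ℝ)..(n + 1 : ℕ), f (u / Y) := by
    rw [intervalIntegral.sum_integral_adjacent_intervals
      (a := fun n : ℕ => (n : ℝ)) fun _ _ => hcont.intervalIntegrable _ _]
    rw [intervalIntegral.integral_comp_div _ hY0.ne', smul_eq_mul, Nat.cast_zero, zero_div,
      intervalIntegral.integral_of_le (by positivity)]
    congr 1
    refine (setIntegral_eq_of_subset_of_forall_sdiff_eq_zero measurableSet_Ioi
      Set.Ioc_subset_Ioi_self fun x hx => hR x (hN1.trans ?_))
    by_contra! h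
    exact hx.2 ⟨hx.1, h.le⟩
  rw [hsum, hint, ← Finset.sum_sub_distrib]
  have hterm : ∀ n : ℕ, |f (n / Y) - ∫ u in (n : ℝ)..(n + 1 : ℕ), f (u / Y)| ≤ K / Y := by
    intro n
    have h1 : f (n / Y) = ∫ u in (n : ℝ)..(n + 1 : ℕ), f (n / Y) := by simp
    rw [h1, ← intervalIntegral.integral_sub intervalIntegrable_const
      (hcont.intervalIntegrable _ _), ← Real.norm_eq_abs]
    refine (intervalIntegral.norm_integral_le_of_norm_le_const (C := K / Y) fun u hu => ?_).trans ?_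
    · rw [Set.uIoc_of_le (by simp), Nat.cast_add_one] at hu
      refine (hK.norm_sub_le _ _).trans ?_
      rw [div_eq_mul_inv (K : ℝ), ← sub_div, norm_div, Real.norm_eq_abs, Real.norm_eq_abs,
        abs_of_pos hY0, div_eq_mul_inv]
      have : |(n : ℝ) - u| ≤ 1 := by rw [abs_le]; constructor <;> linarith [hu.1, hu.2]
      calc (K : ℝ) * (|(n : ℝ) - u| * Y⁻¹) ≤ K * (1 * Y⁻¹) := by gcongr
        _ = _ := by rw [one_mul]
    · simp
  calc _ ≤ ∑ n ∈ Finset.range N, K / Y :=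
        (Finset.abs_sum_le_sum_abs _ _).trans (Finset.sum_le_sum fun n _ => hterm n)
    _ = N * (K / Y) := by rw [Finset.sum_const, Finset.card_range, nsmul_eq_mul]
    _ ≤ (R * Y + 1 * Y) * (K / Y) := by gcongr; linarith
    _ = _ := by field_simp

/-- The main term, after the change of variables `x = u ^ 2`. -/
lemma mellinR_half (Φ : ℝ → ℝ) : 1 / 2 * mellinR Φ (1 / 2) = ∫ u in Set.Ioi (0 : ℝ), Φ (u ^ 2) := by
  have h := integral_comp_rpow_Ioi (fun x => Φ x * x ^ ((1 : ℝ) / 2 - 1)) (p := 2) two_ne_zero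
  rw [mellinR, ← h, ← integral_const_mul]
  refine setIntegral_congr_fun measurableSet_Ioi fun u hu => ?_
  have hu : 0 < u := hu
  have h1 : ((u : ℝ) ^ (2 : ℝ)) ^ ((1 : ℝ) / 2 - 1) = u⁻¹ := by
    rw [← Real.rpow_mul hu.le, ← Real.rpow_neg_one]; norm_num
  simp only [smul_eq_mul]
  rw [h1, abs_two, show (2 : ℝ) - 1 = 1 by norm_num, Real.rpow_one, Real.rpow_two]
  field_simp

lemma sqrt_mul_log_le {N : ℕ} {Z : ℝ} (hZ : 1 ≤ Z) (hN : N ≤ Z) :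
    4 * (√N + 1) * Real.log N ≤ 32 * Z ^ (3 / 4 : ℝ) := by
  have h1 : Real.log N ≤ Z ^ (1 / 4 : ℝ) * 4 := by
    refine (Real.log_le_rpow_div N.cast_nonneg (show (0 : ℝ) < 1 / 4 by norm_num)).trans ?_
    rw [div_eq_mul_inv, one_div, inv_inv]
    gcongr
  have h2 : √(N : ℝ) ≤ Z ^ (1 / 2 : ℝ) := by
    rw [← Real.sqrt_eq_rpow]; gcongr
  have h3 : (1 : ℝ) ≤ Z ^ (1 / 2 : ℝ) := Real.one_le_rpow hZ (by norm_num)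
  have h0 := Real.log_natCast_nonneg N
  calc 4 * (√N + 1) * Real.log N
      ≤ 4 * (Z ^ (1 / 2 : ℝ) + Z ^ (1 / 2 : ℝ)) * (Z ^ (1 / 4 : ℝ) * 4) := by gcongr
    _ = 32 * (Z ^ (1 / 2 : ℝ) * Z ^ (1 / 4 : ℝ)) := by ring
    _ = _ := by rw [← Real.rpow_add (by linarith)]; norm_num

lemma rpow_three_fourths_le {Y : ℝ} (hY : 0 < Y) (hL : 16 ≤ Real.log Y) :
    Y ^ (3 / 4 : ℝ) ≤ Y * Real.exp (-√(Real.log Y)) := by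
  set q := √(Real.log Y) with hq
  have hq4 : 4 ≤ q := Real.le_sqrt_of_sq_le (by linarith)
  have hq2 : q ^ 2 = Real.log Y := Real.sq_sqrt (by linarith)
  nth_rewrite 2 [← Real.exp_log hY]
  rw [Real.rpow_def_of_pos hY, ← Real.exp_add, Real.exp_le_exp]
  nlinarith

/-- The sum of `natLambda` against a smooth weight. -/
lemma exists_abs_tsum_natLambda_sub_le {f : ℝ → ℝ} (hf : ContDiff ℝ 5 f) (hc : HasCompactSupport f)
    (hf0 : f 0 = 0) : ∃ c > 0, ∃ C, ∀ Y : ℝ, 0 < Y → 16 ≤ Real.log Y →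
      |∑' n : ℕ, natLambda n * f (n / Y) - Y * ∫ x in Set.Ioi 0, f x|
        ≤ C * (Y * Real.exp (-c * √(Real.log Y))) := by
  obtain ⟨R, hR0, hR⟩ := exists_eq_zero_of_hasCompactSupport hc
  obtain ⟨M, hM⟩ := hf.continuous.bounded_above_of_compact_support hc
  have hM0 : 0 ≤ M := (norm_nonneg _).trans (hM 0)
  have hgc : HasCompactSupport fun x => (f x : ℂ) := hc.comp_left Complex.ofReal_zero
  obtain ⟨c, hc0, C₂, hC₂⟩ := exists_norm_tsum_inertCoeff_le
    (Complex.ofRealCLM.contDiff.comp hf) hgc (by simp [hf0])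
  obtain ⟨C₃, hC₃⟩ := exists_abs_tsum_sub_integral_le (hf.of_le (by norm_num)) hc
  refine ⟨min c 1, by positivity, M * (32 * (R + 1) ^ (3 / 4 : ℝ)) + |C₂| + |C₃|, fun Y hY hL => ?_⟩
  have hY1 : 1 ≤ Y := by
    rw [← Real.exp_log hY]; exact Real.one_le_exp (by linarith)
  set N := ⌈R * Y⌉₊ with hN
  have hN1 : R ≤ N / Y := by rw [le_div_iff₀ hY]; exact Nat.le_ceil _
  have hN2 : (N : ℝ) ≤ (R + 1) * Y := by
    have := (Nat.ceil_lt_add_one (show 0 ≤ R * Y by positivity)).le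
    rw [hN]; linarith
  have hzero : ∀ n ∉ Finset.range (N + 1), f (n / Y) = 0 := fun n hn => by
    rw [Finset.mem_range, not_lt] at hn
    refine hR _ (hN1.trans ?_)
    gcongr
    omega
  have hcoeff : ∀ n : ℕ, inertCoeff n =
      ((ArithmeticFunction.vonMangoldt n * (1 - (ZMod.χ₄ n : ℤ)) - 1 : ℝ) : ℂ) := fun n => by
    rw [inertCoeff, chiFour_apply]
    push_cast
    ring
  have hsum : ∀ a : ℕ → ℝ, ∑' n : ℕ, a n * f (n / Y) =
      ∑ n ∈ Finset.range (N + 1), a n * f (n / Y) := fun a =>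
    tsum_eq_sum fun n hn => by rw [hzero n hn, mul_zero]
  have h1 : |∑ n ∈ Finset.range (N + 1), (natLambda n -
      ArithmeticFunction.vonMangoldt n * (1 - (ZMod.χ₄ n : ℤ))) * f (n / Y)|
        ≤ M * (32 * (R + 1) ^ (3 / 4 : ℝ)) * Y ^ (3 / 4 : ℝ) := by
    have hZ : 1 ≤ (R + 1) * Y := by nlinarith
    calc _ ≤ ∑ n ∈ Finset.range (N + 1), |natLambda n -
          ArithmeticFunction.vonMangoldt n * (1 - (ZMod.χ₄ n : ℤ))| * M := by
          refine (Finset.abs_sum_le_sum_abs _ _).trans (Finset.sum_le_sum fun n _ => ?_)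
          rw [abs_mul]
          gcongr
          exact hM _
      _ ≤ 32 * ((R + 1) * Y) ^ (3 / 4 : ℝ) * M := by
          rw [← Finset.sum_mul]
          gcongr
          exact sum_abs_natLambda_sub_le.trans (sqrt_mul_log_le hZ hN2)
      _ = _ := by rw [Real.mul_rpow (by linarith) hY.le]; ring
  have h2 : |∑ n ∈ Finset.range (N + 1),
      (ArithmeticFunction.vonMangoldt n * (1 - (ZMod.χ₄ n : ℤ)) - 1) * f (n / Y)|
        ≤ C₂ * (Y * Real.exp (-c * √(Real.log Y))) := by
    rw [← hsum, ← Real.norm_eq_abs, ← Complex.norm_real, Complex.ofReal_tsum]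
    convert hC₂ Y hY (by linarith) using 5 with n
    rw [hcoeff]
    push_cast
    rfl
  have h3 := hC₃ Y hY1
  have h3' := hsum 1
  simp only [Pi.one_apply, one_mul] at h3'
  rw [h3'] at h3
  rw [hsum]
  set E := Y * Real.exp (-(min c 1) * √(Real.log Y)) with hE
  have hE1 : Y ^ (3 / 4 : ℝ) ≤ E := by
    refine (rpow_three_fourths_le hY hL).trans ?_
    rw [hE]
    gcongr
    rw [neg_mul, neg_le_neg_iff]
    exact mul_le_of_le_one_left (Real.sqrt_nonneg _) (min_le_right _ _)
  have hE2 : Y * Real.exp (-c * √(Real.log Y)) ≤ E := by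
    rw [hE]
    gcongr
    exact min_le_left _ _
  have hE3 : 1 ≤ E := (Real.one_le_rpow hY1 (by norm_num)).trans hE1
  have hsplit : ∑ n ∈ Finset.range (N + 1), natLambda n * f (n / Y) - Y * ∫ x in Set.Ioi 0, f x =
      ∑ n ∈ Finset.range (N + 1), (natLambda n -
        ArithmeticFunction.vonMangoldt n * (1 - (ZMod.χ₄ n : ℤ))) * f (n / Y) +
      ∑ n ∈ Finset.range (N + 1),
        (ArithmeticFunction.vonMangoldt n * (1 - (ZMod.χ₄ n : ℤ)) - 1) * f (n / Y) +
      (∑ n ∈ Finset.range (N + 1), f (n / Y) - Y * ∫ x in Set.Ioi 0, f x) := by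
    rw [← add_sub_assoc, ← Finset.sum_add_distrib, ← Finset.sum_add_distrib]
    congr 1
    exact Finset.sum_congr rfl fun n _ => by ring
  rw [hsplit]
  refine (abs_add_three _ _ _).trans ?_
  rw [add_mul, add_mul]
  gcongr
  · exact h1.trans (by gcongr)
  · exact h2.trans (mul_le_mul (le_abs_self _) hE2 (by positivity) (abs_nonneg _))
  · exact (h3.trans (le_abs_self _)).trans (le_mul_of_one_le_right (abs_nonneg _) hE3)

/-- `∑_{θ_𝔞 = 0} Λ(𝔞) Φ(N(𝔞)/X) = (1/2) X^{1/2} Φ̃(1/2) + O(√X e^{-c√(log X)})`. -/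
theorem inert_sum_asymptotic (Φ : ℝ → ℝ) (hΦ : ContDiff ℝ (⊤ : ℕ∞) Φ) (hΦc : HasCompactSupport Φ)
    (hΦsupp : Function.support Φ ⊆ Set.Ioi 0) :
    ∃ c > (0 : ℝ),
      (fun X : ℝ => inertSum Φ X - 1 / 2 * X ^ ((1 : ℝ) / 2) * mellinR Φ (1 / 2))
        =O[atTop] (fun X : ℝ => Real.sqrt X * Real.exp (-c * Real.sqrt (Real.log X))) := by
  have hΦ0 : Φ 0 = 0 := by
    by_contra h
    exact lt_irrefl (0 : ℝ) (Set.mem_Ioi.1 (hΦsupp h))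
  have hf : ContDiff ℝ 5 fun x => Φ (x ^ 2) :=
    (contDiff_infty.1 hΦ 5).comp (contDiff_id.pow 2)
  have hc : HasCompactSupport fun x => Φ (x ^ 2) := by
    obtain ⟨R, hR0, hR⟩ := exists_eq_zero_of_hasCompactSupport hΦc
    refine HasCompactSupport.intro (isCompact_closedBall (0 : ℝ) (R + 1)) fun x hx => hR _ ?_
    rw [mem_closedBall_zero_iff, Real.norm_eq_abs, not_le] at hx
    rw [← sq_abs]
    nlinarith
  obtain ⟨c, hc0, C, hC⟩ := exists_abs_tsum_natLambda_sub_le hf hc (by simpa using hΦ0)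
  refine ⟨c / 2, by positivity, IsBigO.of_bound |C| ?_⟩
  filter_upwards [eventually_gt_atTop 0, Real.tendsto_log_atTop.eventually_ge_atTop 32]
    with X hX hL
  have hY : 0 < √X := Real.sqrt_pos.2 hX
  have hlog : Real.log √X = Real.log X / 2 := Real.log_sqrt hX.le
  have h := hC √X hY (by linarith)
  have hsum : inertSum Φ X = ∑' n : ℕ, natLambda n * Φ ((n / √X) ^ 2) := by
    simp only [inertSum_eq_tsum hΦ0, div_pow, Real.sq_sqrt hX.le, natLambda]
  rw [hsum, mul_comm (1 / 2 : ℝ), mul_assoc, mellinR_half, ← Real.sqrt_eq_rpow, Real.norm_eq_abs]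
  refine h.trans ?_
  rw [Real.norm_of_nonneg (by positivity)]
  refine mul_le_mul (le_abs_self _) ?_ (by positivity) (abs_nonneg _)
  gcongr √X * Real.exp ?_
  have h2 : √(Real.log X) / 2 ≤ √(Real.log √X) := by
    refine Real.le_sqrt_of_sq_le ?_
    rw [div_pow, Real.sq_sqrt (by linarith), hlog]
    linarith
  nlinarith
end
end

section
/- Fix real numbers α, β ∈ (0, 1/2) with α + β ≠ 1/2. Then, as K → ∞ through positive integers, (1/(2K)) · Σ_{k ∈ ℤ, 0 < |k| ≤ K} [Γ(1/2 − α + 2|k|) · Γ(1/2 − β + 2|k|)] / [Γ(1/2 + α + 2|k|) · Γ(1/2 + β + 2|k|)] = (2K)^{−2(α+β)} / (1 − 2(α+β)) + O(K^{−1}). -/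
noncomputable section

open scoped Classical

open Complex Real Filter Asymptotics MeasureTheory

/-- Log-convexity bounds for a quotient of Gamma values whose arguments differ by less than one. -/
lemma Gamma_div_Gamma_add_bounds {y t : ℝ} (hy : 0 < y) (ht : 0 < t) (ht1 : t < 1) :
    y ^ (-t) ≤ Real.Gamma y / Real.Gamma (y + t) ∧
      Real.Gamma y / Real.Gamma (y + t) ≤ y ^ (-t) * (1 + 1 / y) := by
  have hG := Real.Gamma_pos_of_pos hy
  have hyt : 0 < y + t := by linarith
  have hGt := Real.Gamma_pos_of_pos hyt
  have upper : Real.Gamma (y + t) ≤ Real.Gamma y * y ^ t := by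
    have h := Real.Gamma_mul_add_mul_le_rpow_Gamma_mul_rpow_Gamma hy (by linarith : 0 < y + 1)
      (by linarith : 0 < 1 - t) ht (by ring)
    rw [Real.Gamma_add_one hy.ne', Real.mul_rpow hy.le hG.le,
      show (1 - t) * y + t * (y + 1) = y + t by ring] at h
    calc Real.Gamma (y + t) ≤ _ := h
      _ = (Real.Gamma y ^ (1 - t) * Real.Gamma y ^ t) * y ^ t := by ring
      _ = _ := by rw [← Real.rpow_add hG]; simp
  have lower : y * Real.Gamma y ≤ Real.Gamma (y + t) * (y + t) ^ (1 - t) := by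
    have h := Real.Gamma_mul_add_mul_le_rpow_Gamma_mul_rpow_Gamma hyt
      (by linarith : 0 < y + t + 1) ht (by linarith : 0 < 1 - t) (by ring)
    rw [Real.Gamma_add_one hyt.ne', Real.mul_rpow hyt.le hGt.le,
      show t * (y + t) + (1 - t) * (y + t + 1) = y + 1 by ring, Real.Gamma_add_one hy.ne'] at h
    calc y * Real.Gamma y ≤ _ := h
      _ = (Real.Gamma (y + t) ^ t * Real.Gamma (y + t) ^ (1 - t)) * (y + t) ^ (1 - t) := by ring
      _ = _ := by rw [← Real.rpow_add hGt]; simp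
  have hpow : (y + t) ^ (1 - t) ≤ y * (y ^ (-t) * (1 + 1 / y)) := by
    have e : y + t = y * (1 + t / y) := by field_simp
    have h1 : 1 ≤ 1 + t / y := by have := div_pos ht hy; linarith
    have h2 : (1 + t / y) ^ (1 - t) ≤ 1 + 1 / y := by
      calc (1 + t / y) ^ (1 - t) ≤ (1 + t / y) ^ (1 : ℝ) :=
            Real.rpow_le_rpow_of_exponent_le h1 (by linarith)
        _ = 1 + t / y := Real.rpow_one _
        _ ≤ 1 + 1 / y := by gcongr
    rw [e, Real.mul_rpow hy.le (by linarith), sub_eq_add_neg, Real.rpow_add hy, Real.rpow_one,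
      mul_assoc]
    rw [sub_eq_add_neg] at h2
    gcongr
  constructor
  · rw [le_div_iff₀ hGt, Real.rpow_neg hy.le, inv_mul_le_iff₀ (by positivity)]
    linarith
  · rw [div_le_iff₀ hGt]
    refine le_of_mul_le_mul_left ?_ hy
    calc y * Real.Gamma y ≤ _ := lower
      _ ≤ Real.Gamma (y + t) * (y * (y ^ (-t) * (1 + 1 / y))) := by gcongr
      _ = _ := by ring

/-- Bounds for `Γ(1/2 - c + x) / Γ(1/2 + c + x)` by powers independent of the half shift. -/
lemma Gamma_half_sub_div_Gamma_half_add_bounds {c x : ℝ} (hc : c ∈ Set.Ioo (0 : ℝ) (1 / 2))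
    (hx : 0 < x) :
    (x + 2) ^ (-(2 * c)) ≤ Real.Gamma (1 / 2 - c + x) / Real.Gamma (1 / 2 + c + x) ∧
      Real.Gamma (1 / 2 - c + x) / Real.Gamma (1 / 2 + c + x) ≤
        x ^ (-(2 * c)) * (1 + 1 / x) := by
  obtain ⟨hc0, hc1⟩ := hc
  have hy : 0 < 1 / 2 - c + x := by linarith
  obtain ⟨h1, h2⟩ := Gamma_div_Gamma_add_bounds hy (by linarith : 0 < 2 * c) (by linarith)
  rw [show 1 / 2 - c + x + 2 * c = 1 / 2 + c + x by ring] at h1 h2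
  constructor
  · exact (Real.rpow_le_rpow_of_nonpos hy (by linarith) (by linarith)).trans h1
  · refine h2.trans (mul_le_mul (Real.rpow_le_rpow_of_nonpos hx (by linarith) (by linarith)) ?_
      (by positivity) (by positivity))
    have := one_div_le_one_div_of_le hx (by linarith : x ≤ 1 / 2 - c + x)
    linarith

lemma exists_rpow_primitive_sub_eq {s x : ℝ} (hs : s ≠ 1) (hx : 0 < x) :
    ∃ z ∈ Set.Ioo x (x + 2),
      (x + 2) ^ (1 - s) / (1 - s) - x ^ (1 - s) / (1 - s) = 2 * z ^ (-s) := by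
  have hs' : 1 - s ≠ 0 := sub_ne_zero.mpr hs.symm
  have hd : ∀ z : ℝ, 0 < z → HasDerivAt (fun u : ℝ => u ^ (1 - s) / (1 - s)) (z ^ (-s)) z := by
    intro z hz
    have h := (Real.hasDerivAt_rpow_const (p := 1 - s) (Or.inl hz.ne')).div_const (1 - s)
    rwa [show 1 - s - 1 = -s by ring, mul_div_cancel_left₀ _ hs'] at h
  obtain ⟨z, hz, h⟩ := exists_hasDerivAt_eq_slope (fun u : ℝ => u ^ (1 - s) / (1 - s))
    (fun u => u ^ (-s)) (by linarith : x < x + 2)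
    (fun u hu => (hd u (hx.trans_le hu.1)).continuousAt.continuousWithinAt)
    (fun u hu => hd u (hx.trans hu.1))
  refine ⟨z, hz, ?_⟩
  rw [h]
  simp only [add_sub_cancel_left]
  ring

lemma sum_Icc_neg_erase_zero_abs (g : ℝ → ℝ) (K : ℕ) :
    ∑ k ∈ (Finset.Icc (-(K : ℤ)) (K : ℤ)).erase 0, g |(k : ℝ)| =
      2 * ∑ k ∈ Finset.range K, g ((k : ℝ) + 1) := by
  induction K with
  | zero => simp
  | succ K ih =>
    have e : (Finset.Icc (-((K + 1 : ℕ) : ℤ)) ((K + 1 : ℕ) : ℤ)).erase 0 =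
        insert ((K : ℤ) + 1) (insert (-((K : ℤ) + 1))
          ((Finset.Icc (-(K : ℤ)) (K : ℤ)).erase 0)) := by
      ext x
      simp only [Finset.mem_erase, Finset.mem_Icc, Finset.mem_insert]
      push_cast
      omega
    have hK : (0 : ℝ) ≤ (K : ℝ) + 1 := by positivity
    rw [e, Finset.sum_insert (by simp; omega), Finset.sum_insert (by simp), ih,
      Finset.sum_range_succ]
    push_cast
    rw [abs_neg, abs_of_nonneg hK]
    ring

/-- The upper power bound exceeds the lower one by a factor `1 + O(1 / x)`. -/
lemma rpow_neg_mul_sub_rpow_neg_le {s x : ℝ} (hs2 : s < 2) (hx : 1 ≤ x) :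
    x ^ (-s) * (1 + 1 / x) ^ 2 - (x + 2) ^ (-s) ≤ 7 * x ^ (-s - 1) := by
  have hx0 : 0 < x := by linarith
  have e : x + 2 = x * (1 + 2 / x) := by field_simp
  have h1 : 1 ≤ 1 + 2 / x := by have := div_pos two_pos hx0; linarith
  have hle : 1 - 4 * (1 / x) ≤ (1 + 2 / x) ^ (-s) := by
    calc 1 - 4 * (1 / x) ≤ ((1 + 2 / x) ^ 2)⁻¹ := by
          rw [← one_div, le_div_iff₀ (by positivity)]
          have : 0 < 1 / x := by positivity
          rw [show 2 / x = 2 * (1 / x) by ring]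
          nlinarith [pow_pos this 2, pow_pos this 3]
      _ = (1 + 2 / x) ^ (-2 : ℝ) := by rw [Real.rpow_neg (by positivity)]; norm_cast
      _ ≤ _ := Real.rpow_le_rpow_of_exponent_le h1 (by linarith)
  have hu1 : 1 / x ≤ 1 := by rw [div_le_one hx0]; exact hx
  have hu0 : 0 < 1 / x := by positivity
  rw [e, Real.mul_rpow hx0.le (by positivity), Real.rpow_sub_one hx0.ne', ← mul_sub]
  calc x ^ (-s) * ((1 + 1 / x) ^ 2 - (1 + 2 / x) ^ (-s)) ≤ x ^ (-s) * (7 * (1 / x)) := by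
        gcongr
        nlinarith
    _ = _ := by ring

/-- If `f` is squeezed at even integers between the natural bounds for `x ^ (-s)`, then twice its
sum differs from the integral of `x ^ (-s)` by a bounded amount. -/
lemma exists_bound_two_mul_sum_sub {s : ℝ} (hs0 : 0 < s) (hs2 : s < 2) (hs1 : s ≠ 1) {f : ℝ → ℝ}
    (hlo : ∀ x, 0 < x → (x + 2) ^ (-s) ≤ f x)
    (hup : ∀ x, 0 < x → f x ≤ x ^ (-s) * (1 + 1 / x) ^ 2) :
    ∃ C, ∀ K : ℕ, |2 * ∑ k ∈ Finset.range K, f (2 * ((k : ℝ) + 1)) -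
      (2 * ((K : ℝ) + 1)) ^ (1 - s) / (1 - s)| ≤ C := by
  set F : ℝ → ℝ := fun x => x ^ (1 - s) / (1 - s) with hF
  have hsum : Summable fun k : ℕ => 14 * ((k : ℝ) + 1) ^ (-s - 1) := by
    have h := (summable_nat_add_iff 1).mpr
      (Real.summable_nat_rpow.mpr (by linarith : -s - 1 < -1))
    exact (by simpa using h : Summable fun k : ℕ => ((k : ℝ) + 1) ^ (-s - 1)).mul_left 14
  have hterm : ∀ k : ℕ, |2 * f (2 * ((k : ℝ) + 1)) -
      (F (2 * (((k + 1 : ℕ) : ℝ) + 1)) - F (2 * ((k : ℝ) + 1)))| ≤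
        14 * ((k : ℝ) + 1) ^ (-s - 1) := by
    intro k
    have hk : (0 : ℝ) ≤ k := k.cast_nonneg
    set x : ℝ := 2 * ((k : ℝ) + 1) with hx
    have hx0 : 0 < x := by positivity
    obtain ⟨z, ⟨hz1, hz2⟩, hz⟩ := exists_rpow_primitive_sub_eq hs1 hx0
    rw [show 2 * (((k + 1 : ℕ) : ℝ) + 1) = x + 2 by rw [hx]; push_cast; ring]
    simp only [hF]
    rw [hz]
    have hgap := rpow_neg_mul_sub_rpow_neg_le hs2 (by linarith : 1 ≤ x)
    have hzlo : (x + 2) ^ (-s) ≤ z ^ (-s) :=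
      Real.rpow_le_rpow_of_nonpos (by linarith) hz2.le (by linarith)
    have hzup : z ^ (-s) ≤ x ^ (-s) * (1 + 1 / x) ^ 2 := by
      have h1 : z ^ (-s) ≤ x ^ (-s) := Real.rpow_le_rpow_of_nonpos hx0 hz1.le (by linarith)
      have h2 : 1 ≤ (1 + 1 / x) ^ 2 := one_le_pow₀ (by
        have : 0 < 1 / x := by positivity
        linarith)
      exact h1.trans (le_mul_of_one_le_right (by positivity) h2)
    have hxk : x ^ (-s - 1) ≤ ((k : ℝ) + 1) ^ (-s - 1) :=
      Real.rpow_le_rpow_of_nonpos (by positivity) (by linarith) (by linarith)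
    have := hlo x hx0
    have := hup x hx0
    rw [abs_le]
    constructor <;> linarith
  refine ⟨(∑' k : ℕ, 14 * ((k : ℝ) + 1) ^ (-s - 1)) + |F (2 * ((0 : ℕ) + 1 : ℝ))|, fun K => ?_⟩
  have htel := Finset.sum_range_sub (fun k : ℕ => F (2 * ((k : ℝ) + 1))) K
  have hb : |∑ k ∈ Finset.range K, (2 * f (2 * ((k : ℝ) + 1)) -
      (F (2 * (((k + 1 : ℕ) : ℝ) + 1)) - F (2 * ((k : ℝ) + 1))))| ≤
        ∑' k : ℕ, 14 * ((k : ℝ) + 1) ^ (-s - 1) :=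
    (Finset.abs_sum_le_sum_abs _ _).trans ((Finset.sum_le_sum fun k _ => hterm k).trans
      (hsum.sum_le_tsum _ fun k _ => by positivity))
  rw [Finset.sum_sub_distrib, ← Finset.mul_sum, htel] at hb
  calc |2 * ∑ k ∈ Finset.range K, f (2 * ((k : ℝ) + 1)) - F (2 * ((K : ℝ) + 1))|
      = |(2 * ∑ k ∈ Finset.range K, f (2 * ((k : ℝ) + 1)) -
          (F (2 * ((K : ℝ) + 1)) - F (2 * ((0 : ℕ) + 1 : ℝ)))) - F (2 * ((0 : ℕ) + 1 : ℝ))| := by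
        congr 1; ring
    _ ≤ _ := (abs_sub _ _).trans (by gcongr)

/-- Averaged gamma factors over the family `0 < |k| ≤ K`. -/
theorem gamma_factor_average (a b : ℝ) (ha : a ∈ Set.Ioo (0:ℝ) (1/2))
    (hb : b ∈ Set.Ioo (0:ℝ) (1/2)) (hab : a + b ≠ 1/2) :
    (fun K : ℕ =>
        (1 / (2 * (K : ℝ))) *
            ∑ k ∈ (Finset.Icc (-(K : ℤ)) (K : ℤ)).erase 0,
              Real.Gamma (1/2 - a + 2 * |(k : ℝ)|) * Real.Gamma (1/2 - b + 2 * |(k : ℝ)|) /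
                (Real.Gamma (1/2 + a + 2 * |(k : ℝ)|) * Real.Gamma (1/2 + b + 2 * |(k : ℝ)|)) -
          (2 * (K : ℝ)) ^ (-2 * (a + b)) / (1 - 2 * (a + b)))
      =O[atTop] (fun K : ℕ => (K : ℝ)⁻¹) := by
  set s : ℝ := 2 * (a + b) with hs
  have hs0 : 0 < s := by have := ha.1; have := hb.1; linarith
  have hs2 : s < 2 := by have := ha.2; have := hb.2; linarith
  have hs1 : s ≠ 1 := fun h => hab (by linarith)
  set f : ℝ → ℝ := fun x => Real.Gamma (1/2 - a + x) * Real.Gamma (1/2 - b + x) /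
    (Real.Gamma (1/2 + a + x) * Real.Gamma (1/2 + b + x)) with hf
  have hpow : ∀ x : ℝ, 0 < x → x ^ (-s) = x ^ (-(2 * a)) * x ^ (-(2 * b)) := fun x hx => by
    rw [← Real.rpow_add hx]; congr 1; rw [hs]; ring
  obtain ⟨C, hC⟩ := exists_bound_two_mul_sum_sub hs0 hs2 hs1 (f := f)
    (fun x hx => by
      have h1 := (Gamma_half_sub_div_Gamma_half_add_bounds ha hx).1
      have h2 := (Gamma_half_sub_div_Gamma_half_add_bounds hb hx).1
      rw [hpow _ (by linarith), hf]
      simp only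
      rw [mul_div_mul_comm]
      exact mul_le_mul h1 h2 (by positivity) ((by positivity : (0:ℝ) ≤ _).trans h1))
    (fun x hx => by
      have h1 := Gamma_half_sub_div_Gamma_half_add_bounds ha hx
      have h2 := Gamma_half_sub_div_Gamma_half_add_bounds hb hx
      rw [hpow _ hx, hf]
      simp only
      rw [mul_div_mul_comm]
      calc _ ≤ _ := mul_le_mul h1.2 h2.2 ((by positivity : (0:ℝ) ≤ _).trans h2.1) (by positivity)
        _ = _ := by ring)
  refine IsBigO.of_bound (C + 2) ?_
  filter_upwards [eventually_ge_atTop 1] with K hK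
  have hK1 : (1 : ℝ) ≤ K := by exact_mod_cast hK
  have hK0 : (0 : ℝ) < K := by linarith
  rw [sum_Icc_neg_erase_zero_abs (fun x => f (2 * x)) K]
  obtain ⟨z, hz, hzeq⟩ := exists_rpow_primitive_sub_eq hs1 (by positivity : 0 < 2 * (K : ℝ))
  have hz1 : z ^ (-s) ≤ 1 := Real.rpow_le_one_of_one_le_of_nonpos (by linarith [hz.1]) (by linarith)
  have hz0 : 0 ≤ z ^ (-s) := Real.rpow_nonneg (by linarith [hz.1]) _
  have hCK := hC K
  rw [show 2 * ((K : ℝ) + 1) = 2 * K + 2 by ring] at hCK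
  have e : (2 * (K : ℝ)) ^ (-2 * (a + b)) / (1 - s) =
      1 / (2 * (K : ℝ)) * ((2 * (K : ℝ)) ^ (1 - s) / (1 - s)) := by
    rw [show -2 * (a + b) = (1 - s) - 1 by rw [hs]; ring, Real.rpow_sub_one (by positivity)]
    ring
  rw [e, ← mul_sub, norm_mul, mul_comm, Real.norm_eq_abs, Real.norm_eq_abs, Real.norm_eq_abs,
    abs_of_pos (by positivity : 0 < 1 / (2 * (K : ℝ))), abs_of_pos (inv_pos.mpr hK0)]
  have hle : 1 / (2 * (K : ℝ)) ≤ (K : ℝ)⁻¹ := by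
    rw [← one_div]; exact one_div_le_one_div_of_le hK0 (by linarith)
  refine mul_le_mul ?_ hle (by positivity) (by linarith [abs_nonneg _ |>.trans hCK])
  rw [abs_le] at hCK ⊢
  constructor <;> linarith [hCK.1, hCK.2]
end
end
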